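/- arXiv:1806.04567 — 7 statements merged into one kernel-verified Lean document; each statement's English description precedes it below -/
import Mathlib

section
/- Let r* > 0 and set c = r*/2^{1/3} and R(r) = (r*^3 − r^3)^{1/3} for 0 ≤ r ≤ r*. Let B : (0,∞) → [0,∞) be continuous on (0, r*), integrable on (0, r*), and equal to 0 on [r*, ∞). Assume: (II) for all 0 ≤ a ≤ b ≤ c one has ∫_a^b B(r) dr = ∫_{R(b)}^{R(a)} B(r) dr; and (III) ∫_0^c B(r) dr = 1 and ∫_c^{r*} B(r) dr = 1. Then ∫_0^{r*} r^3 B(r) dr = (r*)^3. -/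
open MeasureTheory intervalIntegral

/-- The fundamental theorem of calculus at an interior point of the interval of integration. -/
theorem hasDerivAt_primitive_of_continuousOn_Ioo {f : ℝ → ℝ} {a b x : ℝ}
    (hf : IntervalIntegrable f volume a b) (hc : ContinuousOn f (Set.Ioo a b))
    (hx : x ∈ Set.Ioo a b) :
    HasDerivAt (fun y => ∫ r in a..y, f r) (f x) x := by
  refine integral_hasDerivAt_right ?_ ?_ (hc.continuousAt (isOpen_Ioo.mem_nhds hx))
  · refine hf.mono_set ?_
    rw [Set.uIcc_of_le hx.1.le, Set.uIcc_of_le (hx.1.trans hx.2).le]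
    exact Set.Icc_subset_Icc_right hx.2.le
  · exact hc.stronglyMeasurableAtFilter isOpen_Ioo x hx

/-- If a breakup kernel `B` supported in `(0, r*)` satisfies the
symmetry property (II) relating mass on `[a,b] ⊆ [0, r*/2^{1/3}]` to mass on the
complementary-radius interval, and the normalization (III), then the breakup
conserves volume: `∫_0^{r*} r^3 B(r) dr = (r*)^3`. -/
theorem stmt0 (rstar : ℝ) (hrstar : 0 < rstar)
    (c : ℝ) (hc : c = rstar / (2 : ℝ) ^ ((1 : ℝ) / 3))
    (R : ℝ → ℝ) (hR : ∀ r : ℝ, R r = (rstar ^ 3 - r ^ 3) ^ ((1 : ℝ) / 3))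
    (B : ℝ → ℝ)
    (hBnn : ∀ r : ℝ, 0 < r → 0 ≤ B r)
    (hBcont : ContinuousOn B (Set.Ioo 0 rstar))
    (hBint : IntervalIntegrable B volume 0 rstar)
    (hBzero : ∀ r : ℝ, rstar ≤ r → B r = 0)
    (hII : ∀ a b : ℝ, 0 ≤ a → a ≤ b → b ≤ c →
      ∫ r in a..b, B r = ∫ r in R b..R a, B r)
    (hIII₁ : (∫ r in (0:ℝ)..c, B r) = 1)
    (hIII₂ : (∫ r in c..rstar, B r) = 1) :
    ∫ r in (0:ℝ)..rstar, r ^ 3 * B r = rstar ^ 3 := by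
  have hcpos : 0 < c := by rw [hc]; positivity
  have hc3 : c ^ 3 = rstar ^ 3 / 2 := by
    have h2 : ((2 : ℝ) ^ ((1 : ℝ) / 3)) ^ 3 = 2 := by
      rw [← Real.rpow_natCast, ← Real.rpow_mul (by norm_num)]; norm_num
    rw [hc, div_pow, h2]
  have hcube : ∀ y : ℝ, 0 ≤ y → (y ^ 3) ^ ((1 : ℝ) / 3) = y := fun y hy => by
    rw [← Real.rpow_natCast, ← Real.rpow_mul hy]; norm_num
  have hr3 : 0 < rstar ^ 3 := by positivity
  have hclt : c < rstar := lt_of_pow_lt_pow_left₀ 3 hrstar.le (by linarith)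
  have hR0 : R 0 = rstar := by
    rw [hR, zero_pow three_ne_zero, sub_zero, hcube _ hrstar.le]
  have hRc : R c = c := by
    rw [hR, show rstar ^ 3 - c ^ 3 = c ^ 3 by linarith, hcube _ hcpos.le]
  have hxpos : ∀ x ∈ Set.Icc 0 c, 0 < rstar ^ 3 - x ^ 3 := fun x hx => by
    have := pow_le_pow_left₀ hx.1 hx.2 3
    linarith
  have hRpos : ∀ x ∈ Set.Icc 0 c, 0 < R x := fun x hx => by
    rw [hR]; exact Real.rpow_pos_of_pos (hxpos x hx) _
  have hR3 : ∀ x ∈ Set.Icc 0 c, R x ^ 3 = rstar ^ 3 - x ^ 3 := fun x hx => by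
    rw [hR, ← Real.rpow_natCast, ← Real.rpow_mul (hxpos x hx).le]; norm_num
  have hRle : ∀ x ∈ Set.Icc 0 c, R x ≤ rstar := fun x hx => by
    refine le_of_pow_le_pow_left₀ three_ne_zero hrstar.le ?_
    rw [hR3 x hx]
    have := pow_nonneg hx.1 3
    linarith
  have hRlt : ∀ x ∈ Set.Ioo 0 c, R x < rstar := fun x hx => by
    refine lt_of_pow_lt_pow_left₀ 3 hrstar.le ?_
    rw [hR3 x (Set.Ioo_subset_Icc_self hx)]
    have := pow_pos hx.1 3
    linarith
  have hRcont : Continuous R := by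
    rw [funext hR]
    exact Continuous.rpow_const (by fun_prop) (fun _ => Or.inr (by norm_num))
  have hRderiv : ∀ x ∈ Set.Ioo 0 c, DifferentiableAt ℝ R x := fun x hx => by
    rw [funext hR]
    exact DifferentiableAt.rpow_const (by fun_prop)
      (Or.inl (hxpos x (Set.Ioo_subset_Icc_self hx)).ne')
  have hKint : IntervalIntegrable (fun r => r ^ 3 * B r) volume 0 rstar :=
    hBint.continuousOn_mul (by fun_prop)
  have hKcont : ContinuousOn (fun r => r ^ 3 * B r) (Set.Ioo 0 rstar) :=
    ContinuousOn.mul (by fun_prop) hBcont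
  set H : ℝ → ℝ := fun y => ∫ r in (0:ℝ)..y, B r with hH
  set K : ℝ → ℝ := fun y => ∫ r in (0:ℝ)..y, r ^ 3 * B r with hK
  have hHc : ContinuousOn H (Set.Icc 0 rstar) := by
    have := continuousOn_primitive_interval' hBint Set.left_mem_uIcc
    rwa [Set.uIcc_of_le hrstar.le] at this
  have hKc : ContinuousOn K (Set.Icc 0 rstar) := by
    have := continuousOn_primitive_interval' hKint Set.left_mem_uIcc
    rwa [Set.uIcc_of_le hrstar.le] at this
  have hH' : ∀ x ∈ Set.Ioo 0 rstar, HasDerivAt H (B x) x := fun x hx =>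
    hasDerivAt_primitive_of_continuousOn_Ioo hBint hBcont hx
  have hK' : ∀ x ∈ Set.Ioo 0 rstar, HasDerivAt K (x ^ 3 * B x) x := fun x hx =>
    hasDerivAt_primitive_of_continuousOn_Ioo hKint hKcont hx
  have hsym : ∀ x ∈ Set.Icc 0 c, H x = H rstar - H (R x) := fun x hx => by
    have h := hII 0 x le_rfl hx.1 hx.2
    rw [hR0] at h
    have hi : IntervalIntegrable B volume 0 (R x) := by
      refine hBint.mono_set ?_
      rw [Set.uIcc_of_le (hRpos x hx).le, Set.uIcc_of_le hrstar.le]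
      exact Set.Icc_subset_Icc_right (hRle x hx)
    exact h.trans (integral_interval_sub_left hBint hi).symm
  have hmem : ∀ x ∈ Set.Ioo 0 c, x ∈ Set.Ioo 0 rstar ∧ R x ∈ Set.Ioo 0 rstar := fun x hx =>
    ⟨⟨hx.1, hx.2.trans hclt⟩, hRpos x (Set.Ioo_subset_Icc_self hx), hRlt x hx⟩
  have hB : ∀ x ∈ Set.Ioo 0 c, B x = -(B (R x) * deriv R x) := fun x hx => by
    have h1 := hH' x (hmem x hx).1
    have h2 := ((hH' (R x) (hmem x hx).2).comp x (hRderiv x hx).hasDerivAt).const_sub (H rstar)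
    refine h1.unique (h2.congr_of_eventuallyEq ?_)
    filter_upwards [isOpen_Ioo.mem_nhds hx] with y hy
    exact hsym y (Set.Ioo_subset_Icc_self hy)
  have hG' : ∀ x ∈ Set.Ioo 0 c,
      HasDerivAt (fun x => K x - K (R x) - rstar ^ 3 * H x) 0 x := fun x hx => by
    have h := ((hK' x (hmem x hx).1).sub
      ((hK' (R x) (hmem x hx).2).comp x (hRderiv x hx).hasDerivAt)).sub
      ((hH' x (hmem x hx).1).const_mul (rstar ^ 3))
    refine h.congr_deriv ?_
    rw [hR3 x (Set.Ioo_subset_Icc_self hx)]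
    linear_combination (-(rstar ^ 3 - x ^ 3)) * hB x hx
  have hsub : Set.Icc 0 c ⊆ Set.Icc 0 rstar := Set.Icc_subset_Icc_right hclt.le
  have hGc : ContinuousOn (fun x => K x - K (R x) - rstar ^ 3 * H x) (Set.Icc 0 c) :=
    ((hKc.mono hsub).sub (hKc.comp hRcont.continuousOn
      fun x hx => ⟨(hRpos x hx).le, hRle x hx⟩)).sub
      (continuousOn_const.mul (hHc.mono hsub))
  obtain ⟨_, -, h⟩ := exists_hasDerivAt_eq_slope _ (fun _ => 0) hcpos hGc hG'
  have hH0 : H 0 = 0 := integral_same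
  have hK0 : K 0 = 0 := integral_same
  have hHc1 : H c = 1 := hIII₁
  rw [eq_comm, div_eq_zero_iff, or_iff_left (by linarith), hRc, hR0, hH0, hK0, hHc1] at h
  change K rstar = rstar ^ 3
  linarith
end

section
/- Let 0 < a ≤ b, ν ≥ 0, p ≥ 1, and let B : (0,∞) × (0,∞) → [0,∞) be measurable with B(r, r*) = 0 whenever r ≥ r*, and such that ∫_0^{r*} r^3 B(r, r*) dr = (r*)^3 for every r* > 0. Let Ω ⊆ ℝ^3 be measurable and let f : Ω × ℝ^3 × (0,∞) → [0,∞) be measurable with f(x, ξ, r) = 0 for r ∉ [a, b] and ∫_Ω ∫_{ℝ^3} ∫_0^∞ r^3 |ξ|^p f(x, ξ, r) dr dξ dx < ∞. Then the function (x, ξ, r) ↦ r^3 |ξ|^p Q(f)(x, ξ, r) is integrable on Ω × ℝ^3 × (0,∞) and ∫_Ω ∫_{ℝ^3} ∫_0^∞ r^3 |ξ|^p Q(f)(x, ξ, r) dr dξ dx = 0. -/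
open MeasureTheory

/-- Euclidean three-space. -/
abbrev E3 : Type := EuclideanSpace ℝ (Fin 3)

/-- Rearranging `((y, s), r)` into `((y, r), s)` preserves product measures. -/
lemma measurePreserving_prod_right_comm {Y α β : Type*} [MeasurableSpace Y] [MeasurableSpace α]
    [MeasurableSpace β] (m : Measure Y) (μ : Measure α) (κ : Measure β)
    [SFinite m] [SFinite μ] [SFinite κ] :
    MeasurePreserving (fun z : (Y × α) × β => ((z.1.1, z.2), z.1.2))
      ((m.prod μ).prod κ) ((m.prod κ).prod μ) :=
  ((measurePreserving_prodAssoc m κ μ).symm MeasurableEquiv.prodAssoc).comp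
    (((MeasurePreserving.id m).prod Measure.measurePreserving_swap).comp
      (measurePreserving_prodAssoc m μ κ))

/-- A volume-conserving breakup kernel preserves the `r ^ 3`-moment, also with parameters. -/
lemma integrable_gain_and_integral_gain {Y : Type*} [MeasurableSpace Y] (m : Measure Y) [SFinite m]
    (B : ℝ → ℝ → ℝ)
    (hBmeas : Measurable fun q : ℝ × ℝ => B q.1 q.2)
    (hBnn : ∀ r s : ℝ, 0 < r → 0 < s → 0 ≤ B r s)
    (hBzero : ∀ r s : ℝ, s ≤ r → B r s = 0)
    (hBmass : ∀ s : ℝ, 0 < s → ∫ r in (0:ℝ)..s, r ^ 3 * B r s = s ^ 3)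
    (F : Y × ℝ → ℝ) (hF : Measurable F)
    (hFint : Integrable (fun z : Y × ℝ => z.2 ^ 3 * F z)
      (m.prod (volume.restrict (Set.Ioi (0:ℝ))))) :
    Integrable (fun z : Y × ℝ => z.2 ^ 3 * ∫ s in Set.Ioi z.2, B z.2 s * F (z.1, s))
      (m.prod (volume.restrict (Set.Ioi (0:ℝ)))) ∧
    ∫ z, z.2 ^ 3 * (∫ s in Set.Ioi z.2, B z.2 s * F (z.1, s))
        ∂(m.prod (volume.restrict (Set.Ioi (0:ℝ)))) =
      ∫ z, z.2 ^ 3 * F z ∂(m.prod (volume.restrict (Set.Ioi (0:ℝ)))) := by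
  set pos : Measure ℝ := volume.restrict (Set.Ioi (0:ℝ)) with hpos
  have ae_pos : ∀ᵐ z ∂(m.prod pos), 0 < z.2 :=
    Measure.quasiMeasurePreserving_snd.ae (ae_restrict_mem measurableSet_Ioi)
  have mass_pos : ∀ s : ℝ, 0 < s → ∫ r, r ^ 3 * B r s ∂pos = s ^ 3 := by
    intro s hs
    rw [← hBmass s hs, intervalIntegral.integral_of_le hs.le, hpos]
    refine (setIntegral_eq_of_subset_of_forall_sdiff_eq_zero measurableSet_Ioi
      Set.Ioc_subset_Ioi_self ?_)
    rintro r ⟨hr, hr'⟩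
    have : s ≤ r := by
      by_contra! h
      exact hr' ⟨hr, h.le⟩
    simp [hBzero r s this]
  have int_pos : ∀ s : ℝ, 0 < s → Integrable (fun r => r ^ 3 * B r s) pos := by
    intro s hs
    by_contra h
    have h0 := mass_pos s hs
    rw [integral_undef h] at h0
    exact (pow_pos hs 3).ne h0
  let K : (Y × ℝ) × ℝ → ℝ := fun w => w.2 ^ 3 * B w.2 w.1.2 * F w.1
  have hKmeas : Measurable K := by
    have : Measurable fun w : (Y × ℝ) × ℝ => B w.2 w.1.2 :=
      hBmeas.comp (measurable_snd.prodMk (measurable_snd.comp measurable_fst))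
    exact ((measurable_snd.pow_const 3).mul this).mul (hF.comp measurable_fst)
  have hKint : Integrable K ((m.prod pos).prod pos) := by
    rw [integrable_prod_iff hKmeas.aestronglyMeasurable]
    constructor
    · filter_upwards [ae_pos] with z hz
      exact (int_pos z.2 hz).mul_const (F z)
    · refine hFint.norm.congr ?_
      filter_upwards [ae_pos] with z hz
      have : ∫ r, ‖K (z, r)‖ ∂pos = ∫ r, r ^ 3 * B r z.2 * ‖F z‖ ∂pos := by
        refine integral_congr_ae ?_
        filter_upwards [ae_restrict_mem measurableSet_Ioi] with r hr
        have hr : 0 < r := hr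
        simp only [K, norm_mul]
        rw [Real.norm_of_nonneg (hBnn r z.2 hr hz), Real.norm_of_nonneg (pow_pos hr 3).le]
      rw [this, integral_mul_const, mass_pos z.2 hz, norm_mul,
        Real.norm_of_nonneg (pow_pos hz 3).le]
  have hswap := measurePreserving_prod_right_comm m pos pos
  let L : (Y × ℝ) × ℝ → ℝ := fun w => w.1.2 ^ 3 * B w.1.2 w.2 * F (w.1.1, w.2)
  have hLint : Integrable L ((m.prod pos).prod pos) :=
    hswap.integrable_comp_of_integrable hKint
  have hLK : ∫ w, L w ∂((m.prod pos).prod pos) = ∫ w, K w ∂((m.prod pos).prod pos) := by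
    have h := integral_map (μ := (m.prod pos).prod pos) (f := K) hswap.measurable.aemeasurable
      hKmeas.aestronglyMeasurable
    rw [hswap.map_eq] at h
    exact h.symm
  have inner_eq : ∀ᵐ z ∂(m.prod pos), ∫ s, L (z, s) ∂pos =
      z.2 ^ 3 * ∫ s in Set.Ioi z.2, B z.2 s * F (z.1, s) := by
    filter_upwards [ae_pos] with z hz
    have : ∫ s in Set.Ioi z.2, B z.2 s * F (z.1, s) = ∫ s, B z.2 s * F (z.1, s) ∂pos := by
      refine (setIntegral_eq_of_subset_of_forall_sdiff_eq_zero measurableSet_Ioi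
        (Set.Ioi_subset_Ioi hz.le) ?_).symm
      rintro s ⟨-, hs⟩
      simp [hBzero z.2 s (not_lt.mp hs)]
    rw [this, ← integral_const_mul]
    simp only [L, mul_assoc]
  refine ⟨hLint.integral_prod_left.congr inner_eq, ?_⟩
  rw [← integral_congr_ae inner_eq, ← integral_prod _ hLint, hLK, integral_prod _ hKint]
  refine integral_congr_ae ?_
  filter_upwards [ae_pos] with z hz
  simp only [K]
  rw [integral_mul_const, mass_pos z.2 hz]

/-- If the breakup kernel `B` conserves volume,
`∫_0^{r*} r^3 B(r, r*) dr = (r*)^3`, and `f ≥ 0` is supported in radii `r ∈ [a,b]`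
with finite `p`-th velocity moment weighted by `r^3`, then the fragmentation
operator `Q(f)(x,ξ,r) = -ν f(x,ξ,r) + ν ∫_{r* > r} B(r,r*) f(x,ξ,r*) dr*` satisfies:
`r^3 |ξ|^p Q(f)` is integrable on `Ω × ℝ^3 × (0,∞)` and its integral vanishes. -/
theorem stmt1
    (a b ν p : ℝ) (ha : 0 < a) (hab : a ≤ b) (hν : 0 ≤ ν) (hp : 1 ≤ p)
    (B : ℝ → ℝ → ℝ)
    (hBmeas : Measurable fun q : ℝ × ℝ => B q.1 q.2)
    (hBnn : ∀ r s : ℝ, 0 < r → 0 < s → 0 ≤ B r s)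
    (hBzero : ∀ r s : ℝ, s ≤ r → B r s = 0)
    (hBmass : ∀ s : ℝ, 0 < s → ∫ r in (0:ℝ)..s, r ^ 3 * B r s = s ^ 3)
    (Ω : Set E3) (hΩ : MeasurableSet Ω)
    (f : E3 → E3 → ℝ → ℝ)
    (hfmeas : Measurable fun q : E3 × E3 × ℝ => f q.1 q.2.1 q.2.2)
    (hfnn : ∀ (x ξ : E3) (r : ℝ), 0 ≤ f x ξ r)
    (hfsupp : ∀ (x ξ : E3) (r : ℝ), r ∉ Set.Icc a b → f x ξ r = 0)
    (hfint : IntegrableOn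
      (fun q : E3 × E3 × ℝ => q.2.2 ^ 3 * ‖q.2.1‖ ^ p * f q.1 q.2.1 q.2.2)
      (Ω ×ˢ ((Set.univ : Set E3) ×ˢ Set.Ioi (0:ℝ))))
    (Q : E3 → E3 → ℝ → ℝ)
    (hQ : ∀ (x ξ : E3) (r : ℝ),
      Q x ξ r = -ν * f x ξ r + ν * ∫ s in Set.Ioi r, B r s * f x ξ s) :
    IntegrableOn
      (fun q : E3 × E3 × ℝ => q.2.2 ^ 3 * ‖q.2.1‖ ^ p * Q q.1 q.2.1 q.2.2)
      (Ω ×ˢ ((Set.univ : Set E3) ×ˢ Set.Ioi (0:ℝ))) ∧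
    ∫ q in Ω ×ˢ ((Set.univ : Set E3) ×ˢ Set.Ioi (0:ℝ)),
      q.2.2 ^ 3 * ‖q.2.1‖ ^ p * Q q.1 q.2.1 q.2.2 = 0 := by
  let m : Measure (E3 × E3) := (volume.restrict Ω).prod volume
  let pos : Measure ℝ := volume.restrict (Set.Ioi (0:ℝ))
  have hassoc : MeasurePreserving (MeasurableEquiv.prodAssoc : (E3 × E3) × ℝ ≃ᵐ E3 × E3 × ℝ)
      (m.prod pos) (volume.restrict (Ω ×ˢ ((Set.univ : Set E3) ×ˢ Set.Ioi (0:ℝ)))) := by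
    rw [Measure.volume_eq_prod, ← Measure.prod_restrict, Measure.volume_eq_prod E3 ℝ,
      ← Measure.prod_restrict, Measure.restrict_univ]
    exact measurePreserving_prodAssoc _ _ _
  let F : (E3 × E3) × ℝ → ℝ := fun z => ‖z.1.2‖ ^ p * f z.1.1 z.1.2 z.2
  have hF : Measurable F :=
    ((measurable_snd.comp measurable_fst).norm.pow_const p).mul
      (hfmeas.comp MeasurableEquiv.prodAssoc.measurable)
  have hFint : Integrable (fun z : (E3 × E3) × ℝ => z.2 ^ 3 * F z) (m.prod pos) := by
    refine (hassoc.integrable_comp_of_integrable hfint).congr (Filter.Eventually.of_forall ?_)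
    intro z
    exact mul_assoc _ _ _
  obtain ⟨hgain, hgain_eq⟩ :=
    integrable_gain_and_integral_gain m B hBmeas hBnn hBzero hBmass F hF hFint
  have hsplit : (fun q : E3 × E3 × ℝ => q.2.2 ^ 3 * ‖q.2.1‖ ^ p * Q q.1 q.2.1 q.2.2) ∘
      (MeasurableEquiv.prodAssoc : (E3 × E3) × ℝ ≃ᵐ E3 × E3 × ℝ) =
      fun z => -ν * (z.2 ^ 3 * F z) +
        ν * (z.2 ^ 3 * ∫ s in Set.Ioi z.2, B z.2 s * F (z.1, s)) := by
    funext z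
    have : ∫ s in Set.Ioi z.2, B z.2 s * F (z.1, s) =
        ‖z.1.2‖ ^ p * ∫ s in Set.Ioi z.2, B z.2 s * f z.1.1 z.1.2 s := by
      rw [← integral_const_mul]
      simp only [F, mul_left_comm]
    rw [this]
    change z.2 ^ 3 * ‖z.1.2‖ ^ p * Q z.1.1 z.1.2 z.2 = _
    rw [hQ]
    simp only [F]
    ring
  constructor
  · rw [IntegrableOn, ← hassoc.integrable_comp_emb MeasurableEquiv.prodAssoc.measurableEmbedding,
      hsplit]
    exact (hFint.const_mul _).add (hgain.const_mul _)
  · rw [← hassoc.integral_comp MeasurableEquiv.prodAssoc.measurableEmbedding]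
    refine (integral_congr_ae (Filter.Eventually.of_forall (congrFun hsplit))).trans ?_
    rw [integral_add (hFint.const_mul _) (hgain.const_mul _), integral_const_mul,
      integral_const_mul, hgain_eq]
    ring
end

section
/- Let ν ≥ 0 and let B : (0,∞) × (0,∞) → [0,∞) be measurable with c₀ := sup_{r* > 0} ∫_0^{r*} B(r, r*) dr < ∞. Let Ω ⊆ ℝ^3 be measurable and let f : Ω × ℝ^3 × (0,∞) → ℝ be integrable. Then Q(f) is integrable on Ω × ℝ^3 × (0,∞) and ∫∫∫ |Q(f)| dx dξ dr ≤ ν (1 + c₀) ∫∫∫ |f| dx dξ dr. -/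
open MeasureTheory

/-- Swapping the last two factors of `(α × β) × γ` preserves the product measure. -/
theorem measurePreserving_prod_right_comm_s3 {α β γ : Type*} [MeasurableSpace α]
    [MeasurableSpace β] [MeasurableSpace γ] (μ : Measure α) (lam : Measure β) (κ : Measure γ)
    [SFinite μ] [SFinite lam] [SFinite κ] :
    MeasurePreserving (fun p : (α × β) × γ => ((p.1.1, p.2), p.1.2))
      ((μ.prod lam).prod κ) ((μ.prod κ).prod lam) := by
  have h1 := measurePreserving_prodAssoc μ lam κ
  have h2 := (MeasurePreserving.id μ).prod (Measure.measurePreserving_swap (μ := lam) (ν := κ))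
  have h3 := (measurePreserving_prodAssoc μ κ lam).symm
  exact h3.comp (h2.comp h1)

/-- The gain operator with kernel `B` is bounded on `L¹` by the supremum `c` of the
column integrals of `B`. -/
theorem integrable_gain {Y : Type*} [MeasurableSpace Y] (μ : Measure Y) [SFinite μ]
    {c : ℝ} {B : ℝ → ℝ → ℝ}
    (hBmeas : Measurable fun q : ℝ × ℝ => B q.1 q.2)
    (hBnn : ∀ r s : ℝ, 0 < r → 0 < s → 0 ≤ B r s)
    (hBint : ∀ s : ℝ, 0 < s → IntervalIntegrable (fun r => B r s) volume 0 s)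
    (hc : ∀ s : ℝ, 0 < s → (∫ r in (0:ℝ)..s, B r s) ≤ c)
    {g : Y × ℝ → ℝ} (hg : Integrable g (μ.prod (volume.restrict (Set.Ioi (0:ℝ))))) :
    Integrable (fun p : Y × ℝ => ∫ s in Set.Ioi p.2, B p.2 s * g (p.1, s))
      (μ.prod (volume.restrict (Set.Ioi (0:ℝ)))) ∧
    ∫ p, |∫ s in Set.Ioi p.2, B p.2 s * g (p.1, s)|
        ∂(μ.prod (volume.restrict (Set.Ioi (0:ℝ)))) ≤
      c * ∫ p, |g p| ∂(μ.prod (volume.restrict (Set.Ioi (0:ℝ)))) := by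
  set lam : Measure ℝ := volume.restrict (Set.Ioi (0:ℝ)) with hlam
  have hpos : ∀ᵐ p ∂(μ.prod lam), 0 < p.2 :=
    Measure.quasiMeasurePreserving_snd.ae (p := fun r : ℝ => 0 < r)
      (ae_restrict_mem measurableSet_Ioi)
  let b : ℝ × ℝ → ℝ := {q : ℝ × ℝ | q.1 < q.2}.indicator fun q => B q.1 q.2
  have hb : Measurable b := hBmeas.indicator (measurableSet_lt measurable_fst measurable_snd)
  let G : (Y × ℝ) × ℝ → ℝ := fun p => b (p.2, p.1.2) * g p.1
  have hGm : AEStronglyMeasurable G ((μ.prod lam).prod lam) :=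
    (hb.comp (measurable_snd.prodMk
      (measurable_snd.comp measurable_fst))).aestronglyMeasurable.mul hg.1.comp_fst
  have hcol : ∀ s : ℝ, (fun r => b (r, s)) = (Set.Iio s).indicator fun r => B r s := by
    intro s
    ext r
    simp [b, Set.indicator]
  have hinter : ∀ s : ℝ, Set.Iio s ∩ Set.Ioi 0 = Set.Ioo 0 s := by
    intro s
    ext r
    simp [and_comm]
  have hcolint : ∀ s : ℝ, 0 < s → Integrable (fun r => b (r, s)) lam := by
    intro s hs
    rw [hcol, integrable_indicator_iff measurableSet_Iio, IntegrableOn, hlam,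
      Measure.restrict_restrict measurableSet_Iio, hinter]
    exact ((intervalIntegrable_iff_integrableOn_Ioo_of_le hs.le).1 (hBint s hs))
  have hbnn : ∀ s : ℝ, 0 < s → ∀ᵐ r ∂lam, 0 ≤ b (r, s) := by
    intro s hs
    filter_upwards [ae_restrict_mem measurableSet_Ioi] with r hr
    exact Set.indicator_apply_nonneg fun _ => hBnn r s hr hs
  have hcolle : ∀ s : ℝ, 0 < s → ∫ r, b (r, s) ∂lam ≤ c := by
    intro s hs
    rw [hcol, integral_indicator measurableSet_Iio, hlam,
      Measure.restrict_restrict measurableSet_Iio, hinter, ← integral_Ioc_eq_integral_Ioo,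
      ← intervalIntegral.integral_of_le hs.le]
    exact hc s hs
  have hnorm : ∀ᵐ p ∂(μ.prod lam), ∫ r, ‖G (p, r)‖ ∂lam ≤ c * |g p| := by
    filter_upwards [hpos] with p hp
    have h : ∫ r, ‖G (p, r)‖ ∂lam = ∫ r, b (r, p.2) * |g p| ∂lam := by
      refine integral_congr_ae ?_
      filter_upwards [hbnn p.2 hp] with r hr
      simp only [G, norm_mul, Real.norm_eq_abs, abs_of_nonneg hr]
    rw [h, integral_mul_const]
    exact mul_le_mul_of_nonneg_right (hcolle _ hp) (abs_nonneg _)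
  have hGi : Integrable G ((μ.prod lam).prod lam) := by
    rw [integrable_prod_iff hGm]
    constructor
    · filter_upwards [hpos] with p hp
      exact (hcolint _ hp).mul_const (g p)
    · refine (hg.abs.const_mul c).mono' hGm.norm.integral_prod_right' ?_
      filter_upwards [hnorm] with p hp
      rwa [Real.norm_of_nonneg (integral_nonneg fun _ => norm_nonneg _)]
  have he := measurePreserving_prod_right_comm_s3 μ lam lam
  have hHi : Integrable (fun p : (Y × ℝ) × ℝ => G ((p.1.1, p.2), p.1.2))
      ((μ.prod lam).prod lam) := he.integrable_comp_of_integrable hGi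
  have hgain : (fun p : Y × ℝ => ∫ s, G ((p.1, s), p.2) ∂lam) =ᵐ[μ.prod lam]
      fun p => ∫ s in Set.Ioi p.2, B p.2 s * g (p.1, s) := by
    filter_upwards [hpos] with p hp
    have h : (fun s => G ((p.1, s), p.2)) =
        (Set.Ioi p.2).indicator fun s => B p.2 s * g (p.1, s) := by
      ext s
      by_cases hs : p.2 < s <;> simp [G, b, Set.indicator, hs]
    rw [h, integral_indicator measurableSet_Ioi, hlam,
      Measure.restrict_restrict measurableSet_Ioi,
      Set.inter_eq_left.2 (Set.Ioi_subset_Ioi hp.le)]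
  refine ⟨hHi.integral_prod_left.congr hgain, ?_⟩
  calc ∫ p, |∫ s in Set.Ioi p.2, B p.2 s * g (p.1, s)| ∂(μ.prod lam)
      = ∫ p, ‖∫ s, G ((p.1, s), p.2) ∂lam‖ ∂(μ.prod lam) := by
        refine integral_congr_ae ?_
        filter_upwards [hgain] with p hp
        rw [hp, Real.norm_eq_abs]
    _ ≤ ∫ p, ∫ s, ‖G ((p.1, s), p.2)‖ ∂lam ∂(μ.prod lam) :=
        integral_mono hHi.integral_prod_left.norm hHi.norm.integral_prod_left
          fun p => norm_integral_le_integral_norm _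
    _ = ∫ q, ‖G ((q.1.1, q.2), q.1.2)‖ ∂((μ.prod lam).prod lam) :=
        (integral_prod _ hHi.norm).symm
    _ = ∫ q, ‖G q‖ ∂((μ.prod lam).prod lam) := by
        conv_rhs => rw [← he.map_eq]
        refine (integral_map (f := fun q => ‖G q‖) he.aemeasurable ?_).symm
        rw [he.map_eq]
        exact hGm.norm
    _ = ∫ p, ∫ r, ‖G (p, r)‖ ∂lam ∂(μ.prod lam) := integral_prod _ hGi.norm
    _ ≤ ∫ p, c * |g p| ∂(μ.prod lam) :=
        integral_mono_ae hGi.norm.integral_prod_left (hg.abs.const_mul c) hnorm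
    _ = c * ∫ p, |g p| ∂(μ.prod lam) := integral_const_mul _ _

/-- The fragmentation operator is bounded on `L¹` of a product space. -/
theorem integrable_fragmentation {Y : Type*} [MeasurableSpace Y] (μ : Measure Y) [SFinite μ]
    {ν c : ℝ} (hν : 0 ≤ ν) {B : ℝ → ℝ → ℝ}
    (hBmeas : Measurable fun q : ℝ × ℝ => B q.1 q.2)
    (hBnn : ∀ r s : ℝ, 0 < r → 0 < s → 0 ≤ B r s)
    (hBint : ∀ s : ℝ, 0 < s → IntervalIntegrable (fun r => B r s) volume 0 s)
    (hc : ∀ s : ℝ, 0 < s → (∫ r in (0:ℝ)..s, B r s) ≤ c)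
    {g : Y × ℝ → ℝ} (hg : Integrable g (μ.prod (volume.restrict (Set.Ioi (0:ℝ))))) :
    Integrable (fun p : Y × ℝ => -ν * g p + ν * ∫ s in Set.Ioi p.2, B p.2 s * g (p.1, s))
      (μ.prod (volume.restrict (Set.Ioi (0:ℝ)))) ∧
    ∫ p, |-ν * g p + ν * ∫ s in Set.Ioi p.2, B p.2 s * g (p.1, s)|
        ∂(μ.prod (volume.restrict (Set.Ioi (0:ℝ)))) ≤
      ν * (1 + c) * ∫ p, |g p| ∂(μ.prod (volume.restrict (Set.Ioi (0:ℝ)))) := by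
  obtain ⟨hK, hKle⟩ := integrable_gain μ hBmeas hBnn hBint hc hg
  have hQ := (hg.const_mul (-ν)).add (hK.const_mul ν)
  refine ⟨hQ, ?_⟩
  refine (integral_mono hQ.abs ((hg.abs.const_mul ν).add (hK.abs.const_mul ν))
    fun p => ?_).trans ?_
  · simp only [Pi.add_apply]
    refine (abs_add_le _ _).trans_eq ?_
    rw [abs_mul, abs_mul, abs_neg, abs_of_nonneg hν]
  · simp only [Pi.add_apply]
    rw [integral_add (hg.abs.const_mul ν) (hK.abs.const_mul ν), integral_const_mul,
      integral_const_mul]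
    nlinarith [mul_le_mul_of_nonneg_left hKle hν]

/-- If `c₀ = sup_{r* > 0} ∫_0^{r*} B(r, r*) dr < ∞` and `f` is
integrable on `Ω × ℝ^3 × (0,∞)`, then the fragmentation operator
`Q(f)(x,ξ,r) = -ν f(x,ξ,r) + ν ∫_{r* > r} B(r,r*) f(x,ξ,r*) dr*` is integrable on
`Ω × ℝ^3 × (0,∞)` with `∫∫∫ |Q(f)| ≤ ν (1 + c₀) ∫∫∫ |f|`. -/
theorem stmt3
    (ν c₀ : ℝ) (hν : 0 ≤ ν)
    (B : ℝ → ℝ → ℝ)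
    (hBmeas : Measurable fun q : ℝ × ℝ => B q.1 q.2)
    (hBnn : ∀ r s : ℝ, 0 < r → 0 < s → 0 ≤ B r s)
    (hBint : ∀ s : ℝ, 0 < s → IntervalIntegrable (fun r => B r s) volume 0 s)
    (hc₀ : ∀ s : ℝ, 0 < s → (∫ r in (0:ℝ)..s, B r s) ≤ c₀)
    (Ω : Set E3) (hΩ : MeasurableSet Ω)
    (f : E3 → E3 → ℝ → ℝ)
    (hfint : IntegrableOn (fun q : E3 × E3 × ℝ => f q.1 q.2.1 q.2.2)
      (Ω ×ˢ ((Set.univ : Set E3) ×ˢ Set.Ioi (0:ℝ))))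
    (Q : E3 → E3 → ℝ → ℝ)
    (hQ : ∀ (x ξ : E3) (r : ℝ),
      Q x ξ r = -ν * f x ξ r + ν * ∫ s in Set.Ioi r, B r s * f x ξ s) :
    IntegrableOn (fun q : E3 × E3 × ℝ => Q q.1 q.2.1 q.2.2)
      (Ω ×ˢ ((Set.univ : Set E3) ×ˢ Set.Ioi (0:ℝ))) ∧
    ∫ q in Ω ×ˢ ((Set.univ : Set E3) ×ˢ Set.Ioi (0:ℝ)), |Q q.1 q.2.1 q.2.2| ≤
      ν * (1 + c₀) * ∫ q in Ω ×ˢ ((Set.univ : Set E3) ×ˢ Set.Ioi (0:ℝ)),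
        |f q.1 q.2.1 q.2.2| := by
  have hmp := measurePreserving_prodAssoc ((volume : Measure E3).restrict Ω)
    (volume : Measure E3) ((volume : Measure ℝ).restrict (Set.Ioi 0))
  have hrestr : (volume : Measure (E3 × E3 × ℝ)).restrict
      (Ω ×ˢ ((Set.univ : Set E3) ×ˢ Set.Ioi (0:ℝ))) =
      ((volume : Measure E3).restrict Ω).prod
        ((volume : Measure E3).prod ((volume : Measure ℝ).restrict (Set.Ioi 0))) := by
    rw [Measure.volume_eq_prod, Measure.volume_eq_prod E3 ℝ, ← Measure.prod_restrict,
      ← Measure.prod_restrict, Measure.restrict_univ]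
  have hemb := (MeasurableEquiv.prodAssoc (α := E3) (β := E3) (γ := ℝ)).measurableEmbedding
  rw [IntegrableOn, hrestr] at hfint ⊢
  obtain ⟨h1, h2⟩ := integrable_fragmentation _ hν hBmeas hBnn hBint hc₀
    ((hmp.integrable_comp_emb hemb).2 hfint)
  rw [← hmp.integrable_comp_emb hemb, ← hmp.integral_comp hemb, ← hmp.integral_comp hemb]
  simp only [hQ]
  exact ⟨h1, h2⟩
end

section
/- Let Ω ⊆ ℝ^3 be measurable, 0 < a ≤ b, p ≥ 1, K ≥ 0, and let f : Ω × ℝ^3 × [a, b] → [0,∞) be measurable with f ≤ K almost everywhere and M := ∫_Ω ∫_a^b ∫_{ℝ^3} r^3 |ξ|^p f(x, ξ, r) dξ dr dx < ∞. Define 𝔫(x) = ∫_a^b ∫_{ℝ^3} r f(x, ξ, r) dξ dr. Then there exists a constant C depending only on a, b, p such that ‖𝔫‖_{L^{(3+p)/3}(Ω)} ≤ C (K + 1) M^{3/(3+p)}. -/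
open MeasureTheory

/-- Splitting velocity space at radius `R`: the part `‖ξ‖ ≤ R` is controlled by the pointwise bound
on `g`, the part `‖ξ‖ > R` by the velocity moment. -/
theorem density_le_split {a b p K R r t g : ℝ} (ha : 0 < a) (har : a ≤ r) (hrb : r ≤ b)
    (hp : 0 ≤ p) (hR : 0 < R) (ht : 0 ≤ t) (hg : 0 ≤ g) (hgK : g ≤ K) :
    r * g ≤ (if t ≤ R then b * K else 0) + (a ^ 2)⁻¹ * (R ^ p)⁻¹ * (r ^ 3 * t ^ p * g) := by
  have hr : 0 < r := ha.trans_le har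
  split_ifs with h
  · have h1 : r * g ≤ b * K := mul_le_mul hrb hgK hg (hr.le.trans hrb)
    have h2 : 0 ≤ (a ^ 2)⁻¹ * (R ^ p)⁻¹ * (r ^ 3 * t ^ p * g) := by positivity
    linarith
  · have h1 : R ^ p ≤ t ^ p := Real.rpow_le_rpow hR.le (not_le.1 h).le hp
    have hRp : 0 < R ^ p := Real.rpow_pos_of_pos hR p
    have h2 : a ^ 2 ≤ r ^ 2 := by gcongr
    have h3 : a ^ 2 * R ^ p ≤ r ^ 2 * t ^ p := by gcongr
    rw [zero_add, ← mul_inv, inv_mul_eq_div, le_div_iff₀ (by positivity)]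
    calc r * g * (a ^ 2 * R ^ p) ≤ r * g * (r ^ 2 * t ^ p) := by gcongr
      _ = r ^ 3 * t ^ p * g := by ring

/-- The constant in the density estimate. -/
noncomputable def densityConst (a b : ℝ) : ℝ :=
  b * (b - a) * (volume (Metric.closedBall (0 : E3) 1)).toReal + (a ^ 2)⁻¹

theorem densityConst_pos {a b : ℝ} (ha : 0 < a) (hab : a ≤ b) : 0 < densityConst a b := by
  have hb : 0 ≤ b := ha.le.trans hab
  have hba : 0 ≤ b - a := sub_nonneg.2 hab
  unfold densityConst
  positivity

theorem volume_velocity_ball_prod_Icc (a b : ℝ) {R : ℝ} (hR : 0 < R) :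
    volume (Metric.closedBall (0 : E3) R ×ˢ Set.Icc a b) =
      ENNReal.ofReal (R ^ 3 * (volume (Metric.closedBall (0 : E3) 1)).toReal) *
        ENNReal.ofReal (b - a) := by
  rw [Measure.volume_eq_prod, Measure.prod_prod, Real.volume_Icc,
    Measure.addHaar_closedBall' _ _ hR.le, ENNReal.ofReal_mul (by positivity),
    ENNReal.ofReal_toReal (measure_closedBall_lt_top).ne]
  simp

theorem lintegral_density_le_of_moment_le {a b p K ε : ℝ} (ha : 0 < a) (hab : a ≤ b)
    (hp : 0 ≤ p) (hK : 0 ≤ K) (hε : 0 < ε) {g : E3 × ℝ → ℝ} (hg0 : ∀ y, 0 ≤ g y)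
    (hgK : ∀ᵐ y ∂(volume.restrict ((Set.univ : Set E3) ×ˢ Set.Icc a b)), g y ≤ K)
    (hm : ∫⁻ y in (Set.univ : Set E3) ×ˢ Set.Icc a b,
      ENNReal.ofReal (y.2 ^ 3 * ‖y.1‖ ^ p * g y) ≤ ENNReal.ofReal ε) :
    ∫⁻ y in (Set.univ : Set E3) ×ˢ Set.Icc a b, ENNReal.ofReal (y.2 * g y) ≤
      ENNReal.ofReal (densityConst a b * (K + 1) * ε ^ (3 / (3 + p))) := by
  have hb : 0 ≤ b := ha.le.trans hab
  have hba : 0 ≤ b - a := sub_nonneg.2 hab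
  set V := (volume (Metric.closedBall (0 : E3) 1)).toReal with hV
  have hV0 : 0 ≤ V := ENNReal.toReal_nonneg
  set R := ε ^ (1 / (3 + p)) with hRdef
  have hR : 0 < R := Real.rpow_pos_of_pos hε _
  have hR3 : R ^ 3 = ε ^ (3 / (3 + p)) := by
    rw [hRdef, ← Real.rpow_natCast, ← Real.rpow_mul hε.le]
    congr 1
    push_cast
    ring
  have hRp : (R ^ p)⁻¹ * ε = ε ^ (3 / (3 + p)) := by
    rw [hRdef, ← Real.rpow_mul hε.le, ← Real.rpow_neg hε.le]
    nth_rewrite 2 [← Real.rpow_one ε]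
    rw [← Real.rpow_add hε]
    congr 1
    field_simp
    ring
  have hc : 0 ≤ (a ^ 2)⁻¹ * (R ^ p)⁻¹ := by positivity
  set c := (a ^ 2)⁻¹ * (R ^ p)⁻¹ with hcdef
  set S := (Set.univ : Set E3) ×ˢ Set.Icc a b with hS
  have hSm : MeasurableSet S := MeasurableSet.univ.prod measurableSet_Icc
  have hball : MeasurableSet {y : E3 × ℝ | ‖y.1‖ ≤ R} :=
    measurableSet_le (by fun_prop) measurable_const
  have hinter : {y : E3 × ℝ | ‖y.1‖ ≤ R} ∩ S = Metric.closedBall (0 : E3) R ×ˢ Set.Icc a b := by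
    ext y
    simp [hS]
  calc ∫⁻ y in S, ENNReal.ofReal (y.2 * g y)
      ≤ ∫⁻ y in S, ({y : E3 × ℝ | ‖y.1‖ ≤ R}.indicator (fun _ ↦ ENNReal.ofReal (b * K)) y +
          ENNReal.ofReal c * ENNReal.ofReal (y.2 ^ 3 * ‖y.1‖ ^ p * g y)) := by
        refine lintegral_mono_ae ?_
        filter_upwards [hgK, ae_restrict_mem hSm] with y hy hyS
        have h := density_le_split ha hyS.2.1 hyS.2.2 hp hR (norm_nonneg y.1) (hg0 y) hy
        refine (ENNReal.ofReal_le_ofReal h).trans (ENNReal.ofReal_add_le.trans ?_)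
        rw [ENNReal.ofReal_mul hc]
        gcongr
        by_cases h' : ‖y.1‖ ≤ R <;> simp [h']
    _ = ENNReal.ofReal (b * K) * (ENNReal.ofReal (R ^ 3 * V) * ENNReal.ofReal (b - a)) +
          ENNReal.ofReal c * ∫⁻ y in S, ENNReal.ofReal (y.2 ^ 3 * ‖y.1‖ ^ p * g y) := by
        rw [lintegral_add_left (measurable_const.indicator hball),
          lintegral_const_mul' _ _ ENNReal.ofReal_ne_top, lintegral_indicator_const hball,
          Measure.restrict_apply hball, hinter, volume_velocity_ball_prod_Icc a b hR]
    _ ≤ ENNReal.ofReal (b * K) * (ENNReal.ofReal (R ^ 3 * V) * ENNReal.ofReal (b - a)) +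
          ENNReal.ofReal c * ENNReal.ofReal ε := by gcongr
    _ = ENNReal.ofReal (b * K * (R ^ 3 * V * (b - a)) + c * ε) := by
        rw [← ENNReal.ofReal_mul (by positivity), ← ENNReal.ofReal_mul (by positivity),
          ← ENNReal.ofReal_mul hc, ← ENNReal.ofReal_add (by positivity) (by positivity)]
    _ ≤ ENNReal.ofReal (densityConst a b * (K + 1) * ε ^ (3 / (3 + p))) := by
        apply ENNReal.ofReal_le_ofReal
        have hE : 0 ≤ ε ^ (3 / (3 + p)) := by positivity
        rw [hcdef, mul_assoc (a ^ 2)⁻¹, hRp, hR3, densityConst, ← hV]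
        have h1 : 0 ≤ b * (b - a) * V * ε ^ (3 / (3 + p)) := by positivity
        have h2 : 0 ≤ (a ^ 2)⁻¹ * K * ε ^ (3 / (3 + p)) := by positivity
        nlinarith

/-- Pointwise interpolation estimate of the density by the velocity moment. -/
theorem lintegral_density_rpow_le {a b p K : ℝ} (ha : 0 < a) (hab : a ≤ b)
    (hp : 0 ≤ p) (hK : 0 ≤ K) {g : E3 × ℝ → ℝ} (hg0 : ∀ y, 0 ≤ g y)
    (hgK : ∀ᵐ y ∂(volume.restrict ((Set.univ : Set E3) ×ˢ Set.Icc a b)), g y ≤ K) :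
    (∫⁻ y in (Set.univ : Set E3) ×ˢ Set.Icc a b, ENNReal.ofReal (y.2 * g y)) ^ ((3 + p) / 3) ≤
      ENNReal.ofReal (densityConst a b * (K + 1)) ^ ((3 + p) / 3) *
        ∫⁻ y in (Set.univ : Set E3) ×ˢ Set.Icc a b,
          ENNReal.ofReal (y.2 ^ 3 * ‖y.1‖ ^ p * g y) := by
  have hs : 0 < (3 + p) / 3 := by positivity
  have hC : 0 < densityConst a b * (K + 1) :=
    mul_pos (densityConst_pos ha hab) (by positivity)
  set m := ∫⁻ y in (Set.univ : Set E3) ×ˢ Set.Icc a b,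
    ENNReal.ofReal (y.2 ^ 3 * ‖y.1‖ ^ p * g y) with hm
  rcases eq_or_ne m ⊤ with htop | htop
  · have h0 : ENNReal.ofReal (densityConst a b * (K + 1)) ^ ((3 + p) / 3) ≠ 0 :=
      (ENNReal.rpow_pos (ENNReal.ofReal_pos.2 hC) ENNReal.ofReal_ne_top).ne'
    rw [htop, ENNReal.mul_top h0]
    exact le_top
  · have hcont := ENNReal.continuous_const_mul
      (a := ENNReal.ofReal (densityConst a b * (K + 1)) ^ ((3 + p) / 3))
      (ENNReal.rpow_ne_top_of_nonneg hs.le ENNReal.ofReal_ne_top)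
    have : (nhdsWithin m (Set.Ioi m)).NeBot :=
      nhdsGT_neBot_of_exists_gt ⟨⊤, lt_top_iff_ne_top.2 htop⟩
    refine ge_of_tendsto ((hcont.tendsto m).mono_left (nhdsWithin_le_nhds (s := Set.Ioi m))) ?_
    filter_upwards [self_mem_nhdsWithin,
      nhdsWithin_le_nhds (Iio_mem_nhds (lt_top_iff_ne_top.2 htop))] with e he he'
    have hetop : e ≠ ⊤ := ne_of_lt he'
    have he0 : 0 < e.toReal := ENNReal.toReal_pos (ne_bot_of_gt he) hetop
    have h := lintegral_density_le_of_moment_le ha hab hp hK he0 hg0 hgK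
      (by rw [ENNReal.ofReal_toReal hetop]; exact le_of_lt he)
    refine (ENNReal.rpow_le_rpow h hs.le).trans_eq ?_
    rw [ENNReal.ofReal_mul hC.le, ENNReal.mul_rpow_of_nonneg _ _ hs.le,
      ENNReal.ofReal_rpow_of_nonneg (x := e.toReal ^ (3 / (3 + p))) (by positivity) hs.le,
      ← Real.rpow_mul he0.le]
    have h1 : 3 / (3 + p) * ((3 + p) / 3) = 1 := by field_simp
    rw [h1, Real.rpow_one, ENNReal.ofReal_toReal hetop]

/-- The iterated Bochner integral of a nonnegative function is bounded by the lower integral over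
the product. -/
theorem enorm_iterated_density_le {a b : ℝ} (ha : 0 < a) {g : E3 × ℝ → ℝ} (hg : Measurable g)
    (hg0 : ∀ y, 0 ≤ g y) :
    ‖∫ r in Set.Icc a b, ∫ ξ : E3, r * g (ξ, r)‖ₑ ≤
      ∫⁻ y in (Set.univ : Set E3) ×ˢ Set.Icc a b, ENNReal.ofReal (y.2 * g y) := by
  rw [Measure.volume_eq_prod, ← Measure.prod_restrict, Measure.restrict_univ,
    lintegral_prod_symm _ (by fun_prop)]
  refine (enorm_integral_le_lintegral_enorm _).trans ?_
  refine setLIntegral_mono_ae' measurableSet_Icc (ae_of_all _ fun r hr ↦ ?_)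
  refine (enorm_integral_le_lintegral_enorm _).trans (lintegral_mono fun ξ ↦ ?_)
  rw [Real.enorm_of_nonneg (mul_nonneg (ha.le.trans hr.1) (hg0 _))]

/-- There is a constant `C = C(a,b,p)` such that for every
nonnegative measurable particle distribution `f ≤ K` on `Ω × ℝ^3 × [a,b]` with
finite total `p`-th velocity moment `M = ∫∫∫ r^3 |ξ|^p f`, the macroscopic density
`𝔫(x) = ∫_a^b ∫_{ℝ^3} r f dξ dr` satisfies
`‖𝔫‖_{L^{(3+p)/3}(Ω)} ≤ C (K+1) M^{3/(3+p)}`. -/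
theorem stmt5 (a b p : ℝ) (ha : 0 < a) (hab : a ≤ b) (hp : 1 ≤ p) :
    ∃ C : ℝ, 0 < C ∧
      ∀ (Ω : Set E3), MeasurableSet Ω →
      ∀ K : ℝ, 0 ≤ K →
      ∀ f : E3 → E3 → ℝ → ℝ,
        (Measurable fun q : E3 × E3 × ℝ => f q.1 q.2.1 q.2.2) →
        (∀ (x ξ : E3) (r : ℝ), 0 ≤ f x ξ r) →
        (∀ᵐ q ∂((volume : Measure (E3 × E3 × ℝ)).restrict
            (Ω ×ˢ ((Set.univ : Set E3) ×ˢ Set.Icc a b))),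
          f q.1 q.2.1 q.2.2 ≤ K) →
        IntegrableOn
          (fun q : E3 × E3 × ℝ => q.2.2 ^ 3 * ‖q.2.1‖ ^ p * f q.1 q.2.1 q.2.2)
          (Ω ×ˢ ((Set.univ : Set E3) ×ˢ Set.Icc a b)) →
        ∀ M : ℝ,
          M = (∫ q in Ω ×ˢ ((Set.univ : Set E3) ×ˢ Set.Icc a b),
              q.2.2 ^ 3 * ‖q.2.1‖ ^ p * f q.1 q.2.1 q.2.2) →
          eLpNorm (fun x : E3 => ∫ r in Set.Icc a b, ∫ ξ : E3, r * f x ξ r)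
              (ENNReal.ofReal ((3 + p) / 3)) (volume.restrict Ω) ≤
            ENNReal.ofReal (C * (K + 1) * M ^ (3 / (3 + p))) := by
  have hp0 : 0 ≤ p := zero_le_one.trans hp
  have hs : 0 < (3 + p) / 3 := by positivity
  refine ⟨densityConst a b, densityConst_pos ha hab, ?_⟩
  intro Ω hΩ K hK f hf hf0 hfK hint M hM
  have hC : 0 < densityConst a b * (K + 1) :=
    mul_pos (densityConst_pos ha hab) (by positivity)
  set S := (Set.univ : Set E3) ×ˢ Set.Icc a b with hS
  have hSm : MeasurableSet S := MeasurableSet.univ.prod measurableSet_Icc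
  have hprod : (volume : Measure (E3 × E3 × ℝ)).restrict (Ω ×ˢ S) =
      (volume.restrict Ω).prod (volume.restrict S) := by
    rw [Measure.volume_eq_prod, Measure.prod_restrict]
  have hnonneg : 0 ≤ᵐ[(volume : Measure (E3 × E3 × ℝ)).restrict (Ω ×ˢ S)]
      fun q ↦ q.2.2 ^ 3 * ‖q.2.1‖ ^ p * f q.1 q.2.1 q.2.2 := by
    filter_upwards [ae_restrict_mem (hΩ.prod hSm)] with q hq
    have hr : 0 ≤ q.2.2 := ha.le.trans hq.2.2.1
    have := hf0 q.1 q.2.1 q.2.2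
    simp only [Pi.zero_apply]
    positivity
  have hM0 : 0 ≤ M := hM ▸ integral_nonneg_of_ae hnonneg
  have hMl : ENNReal.ofReal M = ∫⁻ x in Ω, ∫⁻ y in S,
      ENNReal.ofReal (y.2 ^ 3 * ‖y.1‖ ^ p * f x y.1 y.2) := by
    rw [hM, ofReal_integral_eq_lintegral_ofReal hint hnonneg, hprod,
      lintegral_prod _ (by fun_prop)]
  have hfK' : ∀ᵐ x ∂(volume.restrict Ω), ∀ᵐ y ∂(volume.restrict S), f x y.1 y.2 ≤ K := by
    rw [hprod] at hfK
    exact Measure.ae_ae_of_ae_prod hfK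
  rw [eLpNorm_eq_lintegral_rpow_enorm_toReal (ENNReal.ofReal_pos.2 hs).ne' ENNReal.ofReal_ne_top,
    ENNReal.toReal_ofReal hs.le]
  have hbound : ∫⁻ x in Ω, ‖∫ r in Set.Icc a b, ∫ ξ : E3, r * f x ξ r‖ₑ ^ ((3 + p) / 3) ≤
      ENNReal.ofReal (densityConst a b * (K + 1)) ^ ((3 + p) / 3) * ENNReal.ofReal M := by
    rw [hMl, ← lintegral_const_mul' _ _
      (ENNReal.rpow_ne_top_of_nonneg hs.le ENNReal.ofReal_ne_top)]
    refine lintegral_mono_ae ?_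
    filter_upwards [hfK'] with x hx
    have hg : Measurable fun y : E3 × ℝ ↦ f x y.1 y.2 := hf.comp measurable_prodMk_left
    exact (ENNReal.rpow_le_rpow (enorm_iterated_density_le ha hg fun y ↦ hf0 x y.1 y.2)
      hs.le).trans (lintegral_density_rpow_le ha hab hp0 hK (fun y ↦ hf0 x y.1 y.2) hx)
  refine (ENNReal.rpow_le_rpow hbound (by positivity)).trans_eq ?_
  rw [ENNReal.mul_rpow_of_nonneg _ _ (by positivity), ← ENNReal.rpow_mul,
    mul_one_div_cancel hs.ne', ENNReal.rpow_one, ENNReal.ofReal_mul hC.le, one_div_div,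
    ENNReal.ofReal_rpow_of_nonneg hM0 (by positivity)]
end

section
/- Let Ω ⊆ ℝ^3 be measurable, 0 < a ≤ b, p ≥ 1, K ≥ 0, and let f : Ω × ℝ^3 × [a, b] → [0,∞) be measurable with f ≤ K almost everywhere and M := ∫_Ω ∫_a^b ∫_{ℝ^3} r^3 |ξ|^p f(x, ξ, r) dξ dr dx < ∞. Define j(x) = ∫_a^b ∫_{ℝ^3} r ξ f(x, ξ, r) dξ dr ∈ ℝ^3. Then there exists a constant C depending only on a, b, p such that ‖ |j| ‖_{L^{(3+p)/4}(Ω)} ≤ C (K + 1) M^{4/(3+p)}. -/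
open MeasureTheory

/-- Splitting velocity space at a radius `R` bounds the first velocity moment. -/
lemma lintegral_first_moment_le_split {a b p K R : ℝ} (ha : 0 < a) (hab : a ≤ b) (hp : 1 ≤ p)
    (hK : 0 ≤ K) (hR : 0 < R) {f : E3 × ℝ → ℝ} (hf : Measurable f) (hf0 : ∀ q, 0 ≤ f q)
    (hfK : ∀ᵐ q ∂((volume : Measure E3).prod (volume.restrict (Set.Icc a b))), f q ≤ K) :
    ∫⁻ q, ENNReal.ofReal (q.2 * ‖q.1‖ * f q)
        ∂((volume : Measure E3).prod (volume.restrict (Set.Icc a b))) ≤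
      ENNReal.ofReal (b * (b - a) * volume.real (Metric.closedBall (0 : E3) 1) * K * R ^ 4) +
        ENNReal.ofReal ((a ^ 2)⁻¹ * R ^ (1 - p)) *
          ∫⁻ q, ENNReal.ofReal (q.2 ^ 3 * ‖q.1‖ ^ p * f q)
            ∂((volume : Measure E3).prod (volume.restrict (Set.Icc a b))) := by
  have hb : 0 < b := ha.trans_le hab
  set μ := (volume : Measure E3).prod (volume.restrict (Set.Icc a b)) with hμ
  have hr : ∀ᵐ q ∂μ, q.2 ∈ Set.Icc a b :=
    Measure.quasiMeasurePreserving_snd.ae (ae_restrict_mem measurableSet_Icc)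
  have hS : MeasurableSet (Metric.closedBall (0 : E3) R ×ˢ (Set.univ : Set ℝ)) :=
    Metric.isClosed_closedBall.measurableSet.prod MeasurableSet.univ
  calc
    _ ≤ ∫⁻ q, ((Metric.closedBall (0 : E3) R ×ˢ (Set.univ : Set ℝ)).indicator
            (fun _ => ENNReal.ofReal (b * R * K)) q +
          ENNReal.ofReal ((a ^ 2)⁻¹ * R ^ (1 - p)) *
            ENNReal.ofReal (q.2 ^ 3 * ‖q.1‖ ^ p * f q)) ∂μ := by
      refine lintegral_mono_ae ?_
      filter_upwards [hr, hfK] with q hq hqK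
      have hq0 : 0 < q.2 := ha.trans_le hq.1
      have hfq := hf0 q
      by_cases hin : ‖q.1‖ ≤ R
      · rw [Set.indicator_of_mem (by simpa using hin)]
        refine le_add_right (ENNReal.ofReal_le_ofReal ?_)
        gcongr
        exact hq.2
      · push Not at hin
        have hn : 0 < ‖q.1‖ := hR.trans hin
        refine le_add_left ?_
        rw [← ENNReal.ofReal_mul (by positivity)]
        refine ENNReal.ofReal_le_ofReal ?_
        have h1 : ‖q.1‖ ≤ R ^ (1 - p) * ‖q.1‖ ^ p := by
          calc ‖q.1‖ = ‖q.1‖ ^ (1 - p) * ‖q.1‖ ^ p := by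
                rw [← Real.rpow_add hn]; simp
            _ ≤ _ := by
                gcongr ?_ * _
                exact Real.rpow_le_rpow_of_nonpos hR hin.le (by linarith)
        have h2 : q.2 ≤ (a ^ 2)⁻¹ * q.2 ^ 3 := by
          rw [inv_mul_eq_div, le_div_iff₀ (by positivity), pow_succ' q.2 2]
          gcongr
          exact hq.1
        calc q.2 * ‖q.1‖ * f q
            ≤ ((a ^ 2)⁻¹ * q.2 ^ 3) * (R ^ (1 - p) * ‖q.1‖ ^ p) * f q := by gcongr
          _ = _ := by ring
    _ = _ := by
      rw [lintegral_add_left (measurable_const.indicator hS),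
        lintegral_const_mul _ (by fun_prop), lintegral_indicator_const hS, hμ, Measure.prod_prod,
        Measure.addHaar_closedBall' _ _ hR.le, Measure.restrict_apply_univ, Real.volume_Icc,
        ← ofReal_measureReal (μ := (volume : Measure E3))
          (ne_of_lt measure_closedBall_lt_top),
        ← ENNReal.ofReal_mul (by positivity), ← ENNReal.ofReal_mul (by positivity),
        ← ENNReal.ofReal_mul (by positivity)]
      congr 2
      simp only [finrank_euclideanSpace_fin]
      ring

/-- Interpolation of the first velocity moment between an `L^∞` bound and the `p`-th moment. -/
lemma lintegral_first_moment_le {a b p K : ℝ} (ha : 0 < a) (hab : a ≤ b) (hp : 1 ≤ p)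
    (hK : 0 ≤ K) {f : E3 × ℝ → ℝ} (hf : Measurable f) (hf0 : ∀ q, 0 ≤ f q)
    (hfK : ∀ᵐ q ∂((volume : Measure E3).prod (volume.restrict (Set.Icc a b))), f q ≤ K) :
    ∫⁻ q, ENNReal.ofReal (q.2 * ‖q.1‖ * f q)
        ∂((volume : Measure E3).prod (volume.restrict (Set.Icc a b))) ≤
      ENNReal.ofReal
          ((b * (b - a) * volume.real (Metric.closedBall (0 : E3) 1) + (a ^ 2)⁻¹) * (K + 1)) *
        (∫⁻ q, ENNReal.ofReal (q.2 ^ 3 * ‖q.1‖ ^ p * f q)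
            ∂((volume : Measure E3).prod (volume.restrict (Set.Icc a b)))) ^ (4 / (3 + p)) := by
  have hb : 0 < b := ha.trans_le hab
  have hba : 0 ≤ b - a := sub_nonneg.2 hab
  have hr : ∀ᵐ q ∂((volume : Measure E3).prod (volume.restrict (Set.Icc a b))),
      q.2 ∈ Set.Icc a b :=
    Measure.quasiMeasurePreserving_snd.ae (ae_restrict_mem measurableSet_Icc)
  have hsplit := fun R (hR : 0 < R) =>
    lintegral_first_moment_le_split ha hab hp hK hR hf hf0 hfK
  set m := ∫⁻ q, ENNReal.ofReal (q.2 ^ 3 * ‖q.1‖ ^ p * f q)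
    ∂((volume : Measure E3).prod (volume.restrict (Set.Icc a b))) with hm
  set c := b * (b - a) * volume.real (Metric.closedBall (0 : E3) 1) with hc
  have hc0 : 0 ≤ c := by positivity
  rcases eq_or_ne m 0 with h0 | h0
  · rw [hm, lintegral_eq_zero_iff (by fun_prop)] at h0
    refine le_of_eq_of_le ((lintegral_eq_zero_iff (by fun_prop)).2 ?_) zero_le
    filter_upwards [hr, h0] with q hq hq0
    have hqp : 0 < q.2 := ha.trans_le hq.1
    have h1 := hf0 q
    simp only [Pi.zero_apply, ENNReal.ofReal_eq_zero] at hq0 ⊢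
    rcases (norm_nonneg q.1).eq_or_lt with hn | hn
    · simp [← hn]
    · have : f q = 0 := by
        refine le_antisymm ?_ h1
        by_contra! hlt
        exact absurd hq0 (not_le.2 (by positivity))
      simp [this]
  rcases eq_or_ne m ⊤ with ht | ht
  · rw [ht, ENNReal.top_rpow_of_pos (by positivity), ENNReal.mul_top]
    · exact le_top
    · exact (ENNReal.ofReal_pos.2 (by positivity)).ne'
  have hpos : 0 < m.toReal := ENNReal.toReal_pos h0 ht
  refine (hsplit (m.toReal ^ (1 / (3 + p))) (by positivity)).trans ?_
  rw [← ENNReal.ofReal_toReal ht, ENNReal.toReal_ofReal hpos.le,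
    ENNReal.ofReal_rpow_of_pos hpos, ← ENNReal.ofReal_mul (by positivity),
    ← ENNReal.ofReal_mul (by positivity), ← ENNReal.ofReal_add (by positivity) (by positivity)]
  refine ENNReal.ofReal_le_ofReal ?_
  have hp3 : 3 + p ≠ 0 := by positivity
  have e1 : (m.toReal ^ (1 / (3 + p))) ^ 4 = m.toReal ^ (4 / (3 + p)) := by
    rw [← Real.rpow_natCast, ← Real.rpow_mul hpos.le]
    congr 1
    push_cast
    ring
  have e2 : (m.toReal ^ (1 / (3 + p))) ^ (1 - p) * m.toReal = m.toReal ^ (4 / (3 + p)) := by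
    rw [← Real.rpow_mul hpos.le, ← Real.rpow_add_one hpos.ne']
    congr 1
    field_simp
    ring
  rw [e1, mul_assoc (a ^ 2)⁻¹, e2, ← add_mul]
  gcongr
  have : 0 ≤ (a ^ 2)⁻¹ := by positivity
  nlinarith [mul_nonneg this hK]

/-- There is a constant `C = C(a,b,p)` such that for every
nonnegative measurable particle distribution `f ≤ K` on `Ω × ℝ^3 × [a,b]` with
finite total `p`-th velocity moment `M = ∫∫∫ r^3 |ξ|^p f`, the macroscopic current
`j(x) = ∫_a^b ∫_{ℝ^3} r ξ f dξ dr ∈ ℝ^3` satisfies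
`‖ |j| ‖_{L^{(3+p)/4}(Ω)} ≤ C (K+1) M^{4/(3+p)}`. -/
theorem stmt6 (a b p : ℝ) (ha : 0 < a) (hab : a ≤ b) (hp : 1 ≤ p) :
    ∃ C : ℝ, 0 < C ∧
      ∀ (Ω : Set E3), MeasurableSet Ω →
      ∀ K : ℝ, 0 ≤ K →
      ∀ f : E3 → E3 → ℝ → ℝ,
        (Measurable fun q : E3 × E3 × ℝ => f q.1 q.2.1 q.2.2) →
        (∀ (x ξ : E3) (r : ℝ), 0 ≤ f x ξ r) →
        (∀ᵐ q ∂((volume : Measure (E3 × E3 × ℝ)).restrict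
            (Ω ×ˢ ((Set.univ : Set E3) ×ˢ Set.Icc a b))),
          f q.1 q.2.1 q.2.2 ≤ K) →
        IntegrableOn
          (fun q : E3 × E3 × ℝ => q.2.2 ^ 3 * ‖q.2.1‖ ^ p * f q.1 q.2.1 q.2.2)
          (Ω ×ˢ ((Set.univ : Set E3) ×ˢ Set.Icc a b)) →
        ∀ M : ℝ,
          M = (∫ q in Ω ×ˢ ((Set.univ : Set E3) ×ˢ Set.Icc a b),
              q.2.2 ^ 3 * ‖q.2.1‖ ^ p * f q.1 q.2.1 q.2.2) →
          eLpNorm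
              (fun x : E3 => ∫ r in Set.Icc a b, ∫ ξ : E3, (r * f x ξ r) • ξ)
              (ENNReal.ofReal ((3 + p) / 4)) (volume.restrict Ω) ≤
            ENNReal.ofReal (C * (K + 1) * M ^ (4 / (3 + p))) := by
  refine ⟨b * (b - a) * volume.real (Metric.closedBall (0 : E3) 1) + (a ^ 2)⁻¹, ?_, ?_⟩
  · have := sub_nonneg.2 hab
    have := ha.trans_le hab
    positivity
  intro Ω hΩ K hK f hf hf0 hfK hint M hM
  have hC : 0 ≤ b * (b - a) * volume.real (Metric.closedBall (0 : E3) 1) + (a ^ 2)⁻¹ := by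
    have := sub_nonneg.2 hab
    have := ha.trans_le hab
    positivity
  set C := b * (b - a) * volume.real (Metric.closedBall (0 : E3) 1) + (a ^ 2)⁻¹ with hCdef
  set ν := (volume : Measure E3).prod (volume.restrict (Set.Icc a b)) with hν
  have hprod : (volume : Measure (E3 × E3 × ℝ)).restrict
      (Ω ×ˢ ((Set.univ : Set E3) ×ˢ Set.Icc a b)) = (volume.restrict Ω).prod ν := by
    rw [Measure.volume_eq_prod, ← Measure.prod_restrict, Measure.volume_eq_prod,
      ← Measure.prod_restrict, Measure.restrict_univ]
  rw [IntegrableOn, hprod] at hint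
  rw [hprod] at hfK hM
  have hr : ∀ᵐ q ∂ν, q.2 ∈ Set.Icc a b :=
    Measure.quasiMeasurePreserving_snd.ae (ae_restrict_mem measurableSet_Icc)
  have hr3 : ∀ᵐ q ∂((volume.restrict Ω).prod ν), q.2.2 ∈ Set.Icc a b :=
    Measure.quasiMeasurePreserving_snd.ae hr
  have hnn : 0 ≤ᵐ[(volume.restrict Ω).prod ν]
      fun q : E3 × E3 × ℝ => q.2.2 ^ 3 * ‖q.2.1‖ ^ p * f q.1 q.2.1 q.2.2 := by
    filter_upwards [hr3] with q hq
    have : 0 < q.2.2 := ha.trans_le hq.1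
    have := hf0 q.1 q.2.1 q.2.2
    simp only [Pi.zero_apply]
    positivity
  have hM0 : 0 ≤ M := hM ▸ integral_nonneg_of_ae hnn
  set m : E3 → ENNReal := fun x =>
    ∫⁻ q, ENNReal.ofReal (q.2 ^ 3 * ‖q.1‖ ^ p * f x q.1 q.2) ∂ν with hm
  have hmM : ∫⁻ x in Ω, m x = ENNReal.ofReal M := by
    rw [hM, ofReal_integral_eq_lintegral_ofReal hint hnn, lintegral_prod _ (by fun_prop)]
  have hpt : ∀ᵐ x ∂(volume.restrict Ω),
      ‖∫ r in Set.Icc a b, ∫ ξ : E3, (r * f x ξ r) • ξ‖ₑ ≤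
        ENNReal.ofReal (C * (K + 1)) * m x ^ (4 / (3 + p)) := by
    filter_upwards [Measure.ae_ae_of_ae_prod hfK] with x hx
    have hfx : Measurable fun q : E3 × ℝ => f x q.1 q.2 :=
      hf.comp (measurable_const.prodMk measurable_id)
    refine le_trans ?_ (lintegral_first_moment_le ha hab hp hK hfx (fun q => hf0 x q.1 q.2) hx)
    rw [lintegral_prod_symm _ (by fun_prop)]
    refine (enorm_integral_le_lintegral_enorm _).trans (setLIntegral_mono_ae' measurableSet_Icc ?_)
    refine Filter.Eventually.of_forall fun r hr => ?_
    refine (enorm_integral_le_lintegral_enorm _).trans (lintegral_mono fun ξ => ?_)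
    have h1 : 0 < r := ha.trans_le hr.1
    have h2 := hf0 x ξ r
    rw [← ofReal_norm, norm_smul, Real.norm_of_nonneg (by positivity)]
    exact le_of_eq (by ring_nf)
  have hs : 0 < (3 + p) / 4 := by positivity
  have hinv : 4 / (3 + p) * ((3 + p) / 4) = 1 := by field_simp
  rw [eLpNorm_eq_lintegral_rpow_enorm_toReal (by simpa using hs) ENNReal.ofReal_ne_top,
    ENNReal.toReal_ofReal hs.le, one_div_div]
  calc
    _ ≤ (∫⁻ x in Ω, ENNReal.ofReal (C * (K + 1)) ^ ((3 + p) / 4) * m x) ^ (4 / (3 + p)) := by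
      refine ENNReal.rpow_le_rpow (lintegral_mono_ae ?_) (by positivity)
      filter_upwards [hpt] with x hx
      refine (ENNReal.rpow_le_rpow hx hs.le).trans_eq ?_
      rw [ENNReal.mul_rpow_of_nonneg _ _ hs.le, ← ENNReal.rpow_mul, hinv, ENNReal.rpow_one]
    _ = _ := by
      rw [lintegral_const_mul' _ _ (ENNReal.rpow_ne_top_of_nonneg hs.le ENNReal.ofReal_ne_top),
        hmM, ENNReal.mul_rpow_of_nonneg _ _ (by positivity), ← ENNReal.rpow_mul,
        mul_comm ((3 + p) / 4), hinv, ENNReal.rpow_one,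
        ENNReal.ofReal_rpow_of_nonneg hM0 (by positivity), ← ENNReal.ofReal_mul (by positivity)]
end

section
/- Let (Ω, μ) be a finite measure space and let X be a finite-dimensional linear subspace of L^2(μ) such that there is a constant C_X with ‖v‖_{L^∞(μ)} ≤ C_X ‖v‖_{L^2(μ)} for all v ∈ X. Let ρ₁, ρ₂ ∈ L^1(μ) satisfy ρᵢ ≥ ρ̲ > 0 almost everywhere for a constant ρ̲, let ℓ : X → ℝ be a linear functional, and for i = 1, 2 let uᵢ ∈ X be the unique element with ∫_Ω ρᵢ uᵢ v dμ = ℓ(v) for all v ∈ X. Then ‖u₁ − u₂‖_{L^2(μ)} ≤ ρ̲^{−2} C_X^2 ‖ρ₁ − ρ₂‖_{L^1(μ)} · sup{ |ℓ(v)| : v ∈ X, ‖v‖_{L^2(μ)} ≤ 1 }. -/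
open MeasureTheory

namespace WeightedMass

variable {α : Type*} [MeasurableSpace α] {μ : Measure α}

lemma integrable_mul_mul {ρ f g : α → ℝ} {a b : ℝ} (hρ : Integrable ρ μ)
    (hf : AEStronglyMeasurable f μ) (hg : AEStronglyMeasurable g μ)
    (hfa : ∀ᵐ ω ∂μ, |f ω| ≤ a) (hgb : ∀ᵐ ω ∂μ, |g ω| ≤ b) :
    Integrable (fun ω => ρ ω * f ω * g ω) μ :=
  (hρ.mul_bdd (c := a) hf hfa).mul_bdd (c := b) hg hgb

lemma abs_integral_mul_mul_le {ρ f g : α → ℝ} {a b : ℝ} (hρ : Integrable ρ μ)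
    (hfa : ∀ᵐ ω ∂μ, |f ω| ≤ a) (hgb : ∀ᵐ ω ∂μ, |g ω| ≤ b) :
    |∫ ω, ρ ω * f ω * g ω ∂μ| ≤ a * b * ∫ ω, |ρ ω| ∂μ := by
  rw [← integral_const_mul, ← Real.norm_eq_abs]
  refine norm_integral_le_of_norm_le (hρ.abs.const_mul (a * b)) ?_
  filter_upwards [hfa, hgb] with ω hf hg
  rw [Real.norm_eq_abs, abs_mul, abs_mul, mul_assoc, mul_comm]
  gcongr
  exact (abs_nonneg _).trans hf

lemma mul_norm_sq_le_integral {ρ : α → ℝ} {c : ℝ} (hc : ∀ᵐ ω ∂μ, c ≤ ρ ω) (w : Lp ℝ 2 μ)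
    (hw : Integrable (fun ω => ρ ω * w ω * w ω) μ) :
    c * ‖w‖ ^ 2 ≤ ∫ ω, ρ ω * w ω * w ω ∂μ := by
  have hw2 : Integrable (fun ω => w ω * w ω) μ := L2.integrable_inner (𝕜 := ℝ) w w
  have h : ‖w‖ ^ 2 = ∫ ω, w ω * w ω ∂μ := by
    rw [← real_inner_self_eq_norm_sq, L2.inner_def]
    rfl
  rw [h, ← integral_const_mul]
  refine integral_mono_ae (hw2.const_mul c) hw ?_
  filter_upwards [hc] with ω hω
  simp only [mul_assoc]
  exact mul_le_mul_of_nonneg_right hω (mul_self_nonneg _)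

lemma ae_abs_le_of_eLpNorm_top_le {f : α → ℝ} {a : ℝ}
    (h : eLpNorm f ⊤ μ ≤ ENNReal.ofReal a) : ∀ᵐ ω ∂μ, |f ω| ≤ max a 0 := by
  rw [eLpNorm_exponent_top] at h
  filter_upwards [ae_le_eLpNormEssSup (f := f) (μ := μ)] with ω hω
  have h' := (hω.trans h).trans (ENNReal.ofReal_le_ofReal (le_max_left a 0))
  rw [← ofReal_norm] at h'
  exact (ENNReal.ofReal_le_ofReal_iff (le_max_right _ _)).1 h'

lemma abs_apply_le_sSup_mul_norm {E : Type*} [NormedAddCommGroup E] [NormedSpace ℝ E]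
    [FiniteDimensional ℝ E] (l : E →ₗ[ℝ] ℝ) (v : E) :
    |l v| ≤ sSup ((fun v : E => |l v|) '' {v : E | ‖v‖ ≤ 1}) * ‖v‖ := by
  rcases eq_or_ne v 0 with rfl | hv
  · simp
  have hbdd : BddAbove ((fun v : E => |l v|) '' {v : E | ‖v‖ ≤ 1}) := by
    refine ⟨‖LinearMap.toContinuousLinearMap l‖, ?_⟩
    rintro _ ⟨x, hx, rfl⟩
    exact (LinearMap.toContinuousLinearMap l).unit_le_opNorm x hx
  have hv' : 0 < ‖v‖ := norm_pos_iff.2 hv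
  have h := le_csSup hbdd ⟨‖v‖⁻¹ • v, by simp [norm_smul, hv'.ne'], rfl⟩
  simp only [map_smul, smul_eq_mul, abs_mul, abs_inv, abs_norm] at h
  rwa [inv_mul_le_iff₀ hv', mul_comm] at h

end WeightedMass

open WeightedMass

/-- Lipschitz dependence of the Lax–Milgram solution on the density:
with `X ⊆ L²(μ)` finite dimensional, `‖·‖_{L^∞} ≤ C_X ‖·‖_{L²}` on `X`,
`ρ₁, ρ₂ ∈ L¹(μ)` with `ρᵢ ≥ ρ̲ > 0` a.e., and `uᵢ ∈ X` the solutions of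
`∫ ρᵢ uᵢ v dμ = ℓ(v)` for all `v ∈ X`, one has
`‖u₁ − u₂‖ ≤ ρ̲⁻² C_X² ‖ρ₁ − ρ₂‖_{L¹} sup { |ℓ(v)| : v ∈ X, ‖v‖ ≤ 1 }`. -/
theorem stmt11 {α : Type} [MeasurableSpace α] (μ : Measure α) [IsFiniteMeasure μ]
    (X : Submodule ℝ (Lp ℝ 2 μ)) [FiniteDimensional ℝ X]
    (CX : ℝ)
    (hCX : ∀ v : Lp ℝ 2 μ, v ∈ X →
      eLpNorm (fun ω => v ω) ⊤ μ ≤ ENNReal.ofReal (CX * ‖v‖))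
    (ρ₁ ρ₂ : α → ℝ) (hρ₁ : Integrable ρ₁ μ) (hρ₂ : Integrable ρ₂ μ)
    (ρlow : ℝ) (hρlow : 0 < ρlow)
    (hρ₁ge : ∀ᵐ ω ∂μ, ρlow ≤ ρ₁ ω) (hρ₂ge : ∀ᵐ ω ∂μ, ρlow ≤ ρ₂ ω)
    (ℓ : X →ₗ[ℝ] ℝ) (u₁ u₂ : X)
    (hu₁ : ∀ v : X,
      (∫ ω, ρ₁ ω * ((u₁ : Lp ℝ 2 μ) ω) * ((v : Lp ℝ 2 μ) ω) ∂μ) = ℓ v)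
    (hu₂ : ∀ v : X,
      (∫ ω, ρ₂ ω * ((u₂ : Lp ℝ 2 μ) ω) * ((v : Lp ℝ 2 μ) ω) ∂μ) = ℓ v) :
    ‖u₁ - u₂‖ ≤ (ρlow ^ 2)⁻¹ * CX ^ 2 * (∫ ω, |ρ₁ ω - ρ₂ ω| ∂μ)
      * sSup ((fun v : X => |ℓ v|) '' {v : X | ‖v‖ ≤ 1}) := by
  have hb (v : X) : ∀ᵐ ω ∂μ, |(v : Lp ℝ 2 μ) ω| ≤ |CX| * ‖v‖ := by
    filter_upwards [ae_abs_le_of_eLpNorm_top_le (hCX v v.2)] with ω hω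
    refine hω.trans (max_le ?_ (by positivity))
    exact mul_le_mul_of_nonneg_right (le_abs_self _) (norm_nonneg _)
  have hint {ρ : α → ℝ} (hρ : Integrable ρ μ) (u v : X) :
      Integrable (fun ω => ρ ω * (u : Lp ℝ 2 μ) ω * (v : Lp ℝ 2 μ) ω) μ :=
    integrable_mul_mul hρ (Lp.aestronglyMeasurable _) (Lp.aestronglyMeasurable _) (hb u) (hb v)
  set S := sSup ((fun v : X => |ℓ v|) '' {v : X | ‖v‖ ≤ 1})
  set D := ∫ ω, |ρ₁ ω - ρ₂ ω| ∂μ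
  have hD : 0 ≤ D := integral_nonneg fun _ => abs_nonneg _
  have hS : 0 ≤ S := Real.sSup_nonneg (by rintro _ ⟨x, -, rfl⟩; exact abs_nonneg _)
  have hstab : ρlow * ‖u₂‖ ≤ S := by
    have h := mul_norm_sq_le_integral hρ₂ge (u₂ : Lp ℝ 2 μ) (hint hρ₂ u₂ u₂)
    rw [hu₂ u₂, ← Submodule.coe_norm] at h
    have h' := (le_abs_self _).trans (abs_apply_le_sSup_mul_norm ℓ u₂)
    rcases (norm_nonneg u₂).eq_or_lt with h0 | h0
    · simpa [← h0] using hS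
    · refine le_of_mul_le_mul_right ?_ h0
      linarith
  have hpert : ρlow * ‖u₁ - u₂‖ ≤ CX ^ 2 * ‖u₂‖ * D := by
    set w := u₁ - u₂
    have h := mul_norm_sq_le_integral hρ₁ge (w : Lp ℝ 2 μ) (hint hρ₁ w w)
    have hsplit : ∫ ω, ρ₁ ω * (w : Lp ℝ 2 μ) ω * (w : Lp ℝ 2 μ) ω ∂μ
        = -∫ ω, (ρ₁ ω - ρ₂ ω) * (u₂ : Lp ℝ 2 μ) ω * (w : Lp ℝ 2 μ) ω ∂μ := by
      have h₁ : ∫ ω, ρ₁ ω * (w : Lp ℝ 2 μ) ω * (w : Lp ℝ 2 μ) ω ∂μ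
          = ℓ w - ∫ ω, ρ₁ ω * (u₂ : Lp ℝ 2 μ) ω * (w : Lp ℝ 2 μ) ω ∂μ := by
        rw [← hu₁ w, ← integral_sub (hint hρ₁ u₁ w) (hint hρ₁ u₂ w)]
        refine integral_congr_ae ?_
        filter_upwards [Lp.coeFn_sub (u₁ : Lp ℝ 2 μ) (u₂ : Lp ℝ 2 μ)] with ω hω
        have : (w : Lp ℝ 2 μ) ω = (u₁ : Lp ℝ 2 μ) ω - (u₂ : Lp ℝ 2 μ) ω := hω
        rw [this]
        ring
      rw [h₁, ← hu₂ w, ← integral_sub (hint hρ₂ u₂ w) (hint hρ₁ u₂ w), ← integral_neg]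
      congr 1
      ext ω
      ring
    have hle := (neg_le_abs _).trans
      (abs_integral_mul_mul_le (hρ₁.sub hρ₂) (hb u₂) (hb w))
    simp only [Pi.sub_apply] at hle
    rw [hsplit, ← Submodule.coe_norm] at h
    have h' : ρlow * ‖w‖ ^ 2 ≤ |CX| ^ 2 * ‖u₂‖ * D * ‖w‖ := by
      calc _ ≤ _ := h.trans hle
        _ = _ := by ring
    rw [sq_abs] at h'
    rcases (norm_nonneg w).eq_or_lt with h0 | h0
    · rw [← h0, mul_zero]
      positivity
    · refine le_of_mul_le_mul_right ?_ h0
      linarith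
  have hmain : ρlow ^ 2 * ‖u₁ - u₂‖ ≤ CX ^ 2 * D * S := by
    calc ρlow ^ 2 * ‖u₁ - u₂‖ = ρlow * (ρlow * ‖u₁ - u₂‖) := by ring
      _ ≤ ρlow * (CX ^ 2 * ‖u₂‖ * D) := by gcongr
      _ = CX ^ 2 * D * (ρlow * ‖u₂‖) := by ring
      _ ≤ CX ^ 2 * D * S := by gcongr
  rw [mul_assoc, mul_assoc, le_inv_mul_iff₀ (by positivity), ← mul_assoc]
  exact hmain
end

section
/- Let T > 0, ε > 0, and let 𝕋^3 = (ℝ/ℤ)^3 be the three-dimensional torus. Let u : [0, T] × 𝕋^3 → ℝ^3 be continuous with continuous spatial derivatives, and let ρ : [0, T] × 𝕋^3 → ℝ be continuous with continuous partial derivatives ∂_t ρ, ∇_x ρ and ∇_x^2 ρ, satisfying pointwise the regularized continuity equation ∂_t ρ + div_x(ρ u) = ε Δ_x ρ on [0, T] × 𝕋^3. Assume 0 < ρ̲ ≤ ρ(0, x) ≤ ρ̄ for all x ∈ 𝕋^3. Then for all (t, x) ∈ [0, T] × 𝕋^3: ρ̲ exp( −∫_0^t max_{y ∈ 𝕋^3}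 |div_x u(s, y)| ds ) ≤ ρ(t, x) ≤ ρ̄ exp( ∫_0^t max_{y ∈ 𝕋^3} |div_x u(s, y)| ds ). -/
open MeasureTheory

/-- A function on `[0, t]` that is largest at the right endpoint has nonnegative derivative there. -/
lemma HasDerivAt.nonneg_of_forall_le_right {f : ℝ → ℝ} {f' t : ℝ} (hf : HasDerivAt f f' t)
    (ht : 0 < t) (hmax : ∀ s ∈ Set.Icc 0 t, f s ≤ f t) : 0 ≤ f' := by
  refine ge_of_tendsto (hasDerivAt_iff_tendsto_slope_left_right.1 hf).1 ?_
  filter_upwards [Ioo_mem_nhdsLT ht] with s hs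
  rw [slope_def_field]
  exact div_nonneg_of_nonpos (by linarith [hmax s ⟨hs.1.le, hs.2.le⟩]) (by linarith [hs.2])

/-- Necessary second-order condition at a local maximum. -/
lemma IsLocalMax.deriv_deriv_nonpos {f : ℝ → ℝ} {a : ℝ} (h : IsLocalMax f a)
    (hc : ContinuousAt f a) : deriv (deriv f) a ≤ 0 := by
  by_contra! hpos
  have hmin := isLocalMin_of_deriv_deriv_pos hpos h.deriv_eq_zero hc
  have heq : f =ᶠ[nhds a] fun _ => f a := by
    filter_upwards [h, hmin] with s h₁ h₂ using le_antisymm h₁ h₂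
  have := heq.deriv.deriv_eq
  simp at this
  linarith

/-- At a global maximum, pure second directional derivatives are nonpositive. -/
lemma fderiv_fderiv_nonpos_of_forall_le {E : Type*} [NormedAddCommGroup E] [NormedSpace ℝ E]
    {f : E → ℝ} (hf : ContDiff ℝ 2 f) {x : E} (hmax : ∀ y, f y ≤ f x) (e : E) :
    fderiv ℝ (fun y => fderiv ℝ f y e) x e ≤ 0 := by
  have hline : ∀ s : ℝ, HasDerivAt (fun s : ℝ => x + s • e) e s := fun s => by
    simpa using ((hasDerivAt_id s).smul_const e).const_add x
  have hd : Differentiable ℝ f := hf.differentiable (by norm_num)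
  have hdd : Differentiable ℝ (fun y => fderiv ℝ f y e) :=
    ((hf.fderiv_right (m := 1) (by norm_num)).differentiable (by norm_num)).clm_apply
      (differentiable_const e)
  have h₁ : deriv (fun s : ℝ => f (x + s • e)) = fun s => fderiv ℝ f (x + s • e) e :=
    funext fun s => ((hd _).hasFDerivAt.comp_hasDerivAt s (hline s)).deriv
  have h₂ : deriv (fun s : ℝ => fderiv ℝ f (x + s • e) e) 0
      = fderiv ℝ (fun y => fderiv ℝ f y e) x e := by
    simpa [Function.comp_def] using
      ((hdd (x + (0 : ℝ) • e)).hasFDerivAt.comp_hasDerivAt 0 (hline 0)).deriv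
  have hloc : IsLocalMax (fun s : ℝ => f (x + s • e)) 0 :=
    Filter.Eventually.of_forall fun s => by simpa using hmax (x + s • e)
  have := hloc.deriv_deriv_nonpos
    ((hd _).continuousAt.comp (hline 0).continuousAt)
  rwa [h₁, h₂] at this

/-- Abstract parabolic maximum principle: if the time derivative `p` of `φ` is at most `β φ` at
every spatial maximum where `φ exp (-B)` exceeds `c`, with `B' = β`, then `φ ≤ c exp B`. -/
lemma le_mul_exp_of_deriv_le_at_max {X : Type*} [TopologicalSpace X] {K : Set X}
    (hK : IsCompact K) {T c : ℝ} {φ p : ℝ → X → ℝ} {B β : ℝ → ℝ}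
    (hφ : ContinuousOn (fun q : ℝ × X => φ q.1 q.2) (Set.Icc 0 T ×ˢ Set.univ))
    (hred : ∀ x, ∃ y ∈ K, ∀ t, φ t y = φ t x)
    (hp : ∀ t ∈ Set.Icc 0 T, ∀ x, HasDerivAt (fun s => φ s x) (p t x) t)
    (hB : ∀ t, HasDerivAt B (β t) t) (hB0 : B 0 = 0) (h0 : ∀ x, φ 0 x ≤ c)
    (hmax : ∀ t ∈ Set.Icc 0 T, ∀ x, (∀ y, φ t y ≤ φ t x) → c < φ t x * Real.exp (-B t) →
      p t x ≤ β t * φ t x) :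
    ∀ t ∈ Set.Icc 0 T, ∀ x, φ t x ≤ c * Real.exp (B t) := by
  intro t₁ ht₁ x₁
  obtain ⟨y₁, hy₁, hy⟩ := hred x₁
  rw [← hy]
  by_contra! hlt
  have hlt' : c < φ t₁ y₁ * Real.exp (-B t₁) := by
    rwa [Real.exp_neg, ← div_eq_mul_inv, lt_div_iff₀ (Real.exp_pos _)]
  obtain ⟨δ, hδ, hδt⟩ : ∃ δ > 0, c < φ t₁ y₁ * Real.exp (-B t₁) - δ * t₁ := by
    have ht₁' : 0 < t₁ + 1 := by linarith [ht₁.1]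
    refine ⟨(φ t₁ y₁ * Real.exp (-B t₁) - c) / (t₁ + 1),
      div_pos (by linarith) ht₁', ?_⟩
    have : (φ t₁ y₁ * Real.exp (-B t₁) - c) / (t₁ + 1) * t₁
        < φ t₁ y₁ * Real.exp (-B t₁) - c := by
      rw [div_mul_eq_mul_div, div_lt_iff₀ ht₁']
      nlinarith
    linarith
  have hBc : Continuous B := continuous_iff_continuousAt.2 fun t => (hB t).continuousAt
  have hw : ContinuousOn (fun q : ℝ × X => φ q.1 q.2 * Real.exp (-B q.1) - δ * q.1)
      (Set.Icc 0 T ×ˢ K) :=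
    ((hφ.mono (Set.prod_mono_right (Set.subset_univ K))).mul
      (by fun_prop : Continuous fun q : ℝ × X => Real.exp (-B q.1)).continuousOn).sub
      (by fun_prop : Continuous fun q : ℝ × X => δ * q.1).continuousOn
  obtain ⟨⟨t₀, x₀⟩, ⟨ht₀, hx₀⟩, hmx⟩ :=
    (isCompact_Icc.prod hK).exists_isMaxOn ⟨(t₁, y₁), ht₁, hy₁⟩ hw
  have hmx' : ∀ t ∈ Set.Icc 0 T, ∀ x ∈ K, φ t x * Real.exp (-B t) - δ * t
      ≤ φ t₀ x₀ * Real.exp (-B t₀) - δ * t₀ := fun t ht x hx => hmx (Set.mk_mem_prod ht hx)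
  have hval : c < φ t₀ x₀ * Real.exp (-B t₀) - δ * t₀ := hδt.trans_le (hmx' _ ht₁ _ hy₁)
  simp only at ht₀ hx₀
  have ht₀pos : 0 < t₀ := by
    refine ht₀.1.lt_of_ne fun h => ?_
    subst h
    simp only [hB0, neg_zero, Real.exp_zero, mul_one, mul_zero, sub_zero] at hval
    linarith [h0 x₀]
  have hspace : ∀ y, φ t₀ y ≤ φ t₀ x₀ := fun y => by
    obtain ⟨z, hz, hzy⟩ := hred y
    rw [← hzy]
    exact le_of_mul_le_mul_right (by linarith [hmx' t₀ ht₀ z hz]) (Real.exp_pos (-B t₀))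
  have hle := hmax t₀ ht₀ x₀ hspace (by nlinarith)
  have hder := ((hp t₀ ht₀ x₀).mul (hB t₀).neg.exp).sub ((hasDerivAt_id t₀).const_mul δ)
  have hnn := hder.nonneg_of_forall_le_right ht₀pos
    fun s hs => hmx' s ⟨hs.1, hs.2.trans ht₀.2⟩ x₀ hx₀
  rw [Pi.neg_apply] at hnn
  nlinarith [mul_le_mul_of_nonneg_right hle (Real.exp_pos (-B t₀)).le]

/-- The closed unit cube, a fundamental domain for `ℤ³`. -/
def unitCube : Set E3 := WithLp.toLp 2 '' Set.pi Set.univ fun _ => Set.Icc (0 : ℝ) 1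

lemma isCompact_unitCube : IsCompact unitCube :=
  (isCompact_univ_pi fun _ => isCompact_Icc).image (PiLp.continuous_toLp 2 _)

lemma exists_mem_unitCube_forall_eq (x : E3) : ∃ y ∈ unitCube, ∀ f : E3 → ℝ,
    (∀ (z : E3) (i : Fin 3), f (z + EuclideanSpace.single i (1 : ℝ)) = f z) → f y = f x := by
  refine ⟨WithLp.toLp 2 fun i => Int.fract (x i), ⟨_, fun i _ =>
    ⟨Int.fract_nonneg _, (Int.fract_lt_one _).le⟩, rfl⟩, fun f hf => ?_⟩
  have hp : ∀ (i : Fin 3) (n : ℤ),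
      Function.Periodic f (n • EuclideanSpace.single i (1 : ℝ)) :=
    fun i n => Function.Periodic.zsmul (fun z => hf z i) n
  rw [← hp 0 ⌊x 0⌋, ← hp 1 ⌊x 1⌋, ← hp 2 ⌊x 2⌋]
  congr 1
  ext i
  fin_cases i <;> simp [Int.fract_add_floor]

/-- The spatial divergence of a vector field on Euclidean three-space. -/
noncomputable def divergence (v : E3 → E3) (x : E3) : ℝ :=
  ∑ i : Fin 3, fderiv ℝ v x (EuclideanSpace.single i (1 : ℝ)) i

lemma sum_fderiv_mul_apply {f : E3 → ℝ} {v : E3 → E3} {x : E3} (hf : DifferentiableAt ℝ f x)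
    (hv : DifferentiableAt ℝ v x) :
    ∑ i : Fin 3, fderiv ℝ (fun y => f y * v y i) x (EuclideanSpace.single i (1 : ℝ))
      = f x * divergence v x
        + ∑ i : Fin 3, v x i * fderiv ℝ f x (EuclideanSpace.single i (1 : ℝ)) := by
  rw [divergence, Finset.mul_sum, ← Finset.sum_add_distrib]
  refine Finset.sum_congr rfl fun i _ => ?_
  have hvi : HasFDerivAt (fun y => v y i)
      ((EuclideanSpace.proj i : E3 →L[ℝ] ℝ).comp (fderiv ℝ v x)) x :=
    (EuclideanSpace.proj i : E3 →L[ℝ] ℝ).hasFDerivAt.comp x hv.hasFDerivAt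
  rw [(hf.hasFDerivAt.fun_mul hvi).fderiv]
  simp

lemma divergence_add_single {v : E3 → E3}
    (hv : ∀ (x : E3) (i : Fin 3), v (x + EuclideanSpace.single i (1 : ℝ)) = v x)
    (x : E3) (i : Fin 3) : divergence v (x + EuclideanSpace.single i (1 : ℝ)) = divergence v x := by
  have : fderiv ℝ v (x + EuclideanSpace.single i (1 : ℝ)) = fderiv ℝ v x := by
    rw [← fderiv_comp_add_right]
    simp only [hv]
  simp only [divergence, this]

/-- For a jointly continuous family of periodic functions, the supremum is a pointwise upper bound
and agrees on `[0, T]` with a continuous function of time. -/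
lemma exists_continuous_eq_iSup_abs {T : ℝ} (hT : 0 ≤ T) {d : ℝ → E3 → ℝ}
    (hd : ContinuousOn (fun q : ℝ × E3 => d q.1 q.2) (Set.Icc 0 T ×ˢ Set.univ))
    (hper : ∀ (t : ℝ) (x : E3) (i : Fin 3),
      d t (x + EuclideanSpace.single i (1 : ℝ)) = d t x) :
    ∃ m : ℝ → ℝ, Continuous m ∧ (∀ t ∈ Set.Icc 0 T, m t = ⨆ y, |d t y|) ∧
      ∀ t ∈ Set.Icc 0 T, ∀ x, |d t x| ≤ m t := by
  set g : ℝ → E3 → ℝ := fun t y => |d (max 0 (min t T)) y| with hg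
  have hgc : Continuous (fun q : ℝ × E3 => g q.1 q.2) :=
    (hd.comp_continuous (f := fun q : ℝ × E3 => (max 0 (min q.1 T), q.2)) (by fun_prop)
      fun q => ⟨⟨le_max_left _ _, max_le hT (min_le_right _ _)⟩, trivial⟩).abs
  have hproj : ∀ t ∈ Set.Icc 0 T, ∀ y, g t y = |d t y| := fun t ht y => by
    simp only [hg, min_eq_left ht.2, max_eq_right ht.1]
  have himg : ∀ t, g t '' unitCube = Set.range (g t) := fun t => by
    refine (Set.image_subset_range _ _).antisymm ?_
    rintro _ ⟨x, rfl⟩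
    obtain ⟨y, hy, hyx⟩ := exists_mem_unitCube_forall_eq x
    exact ⟨y, hy, hyx (g t) fun z i => by simp only [hg, hper]⟩
  refine ⟨fun t => sSup (g t '' unitCube), isCompact_unitCube.continuous_sSup hgc, ?_, ?_⟩
  · intro t ht
    simp only [himg, ← hproj t ht, iSup]
  · intro t ht x
    rw [← hproj t ht x]
    refine le_csSup (isCompact_unitCube.bddAbove_image
      (hgc.comp (by fun_prop : Continuous fun y : E3 => (t, y))).continuousOn) ?_
    rw [himg]
    exact Set.mem_range_self x

/-- Maximum-principle bounds for the regularized continuity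
equation `∂ₜ ρ + div(ρ u) = ε Δρ` on `[0,T] × 𝕋³` (functions on the torus are
modelled as `ℤ³`-periodic functions on `ℝ³`): if `0 < ρ̲ ≤ ρ(0,·) ≤ ρ̄`, then for
all `t ∈ [0,T]` and `x`,
`ρ̲ exp(−∫₀ᵗ max_y |div u(s,y)| ds) ≤ ρ(t,x) ≤ ρ̄ exp(∫₀ᵗ max_y |div u(s,y)| ds)`. -/
theorem stmt16 (T ε ρlow ρhigh : ℝ) (hT : 0 < T) (hε : 0 < ε)
    (u : ℝ → E3 → E3)
    (hucont : ContinuousOn (fun q : ℝ × E3 => u q.1 q.2)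
      (Set.Icc 0 T ×ˢ (Set.univ : Set E3)))
    (hudiff : ∀ t ∈ Set.Icc (0:ℝ) T, Differentiable ℝ (u t))
    (hudcont : ContinuousOn (fun q : ℝ × E3 => fderiv ℝ (u q.1) q.2)
      (Set.Icc 0 T ×ˢ (Set.univ : Set E3)))
    (huper : ∀ (t : ℝ) (x : E3) (i : Fin 3),
      u t (x + EuclideanSpace.single i (1:ℝ)) = u t x)
    (ρ : ℝ → E3 → ℝ)
    (hρcont : ContinuousOn (fun q : ℝ × E3 => ρ q.1 q.2)
      (Set.Icc 0 T ×ˢ (Set.univ : Set E3)))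
    (hρt : ∀ (x : E3), ∀ t ∈ Set.Icc (0:ℝ) T, DifferentiableAt ℝ (fun s => ρ s x) t)
    (hρtcont : ContinuousOn (fun q : ℝ × E3 => deriv (fun s => ρ s q.2) q.1)
      (Set.Icc 0 T ×ˢ (Set.univ : Set E3)))
    (hρx : ∀ t ∈ Set.Icc (0:ℝ) T, ContDiff ℝ 2 (ρ t))
    (hρxcont : ContinuousOn (fun q : ℝ × E3 => fderiv ℝ (ρ q.1) q.2)
      (Set.Icc 0 T ×ˢ (Set.univ : Set E3)))
    (hρxxcont : ContinuousOn (fun q : ℝ × E3 => fderiv ℝ (fderiv ℝ (ρ q.1)) q.2)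
      (Set.Icc 0 T ×ˢ (Set.univ : Set E3)))
    (hρper : ∀ (t : ℝ) (x : E3) (i : Fin 3),
      ρ t (x + EuclideanSpace.single i (1:ℝ)) = ρ t x)
    (hPDE : ∀ t ∈ Set.Icc (0:ℝ) T, ∀ x : E3,
      deriv (fun s => ρ s x) t
        + (∑ i : Fin 3,
            fderiv ℝ (fun y : E3 => ρ t y * u t y i) x (EuclideanSpace.single i (1:ℝ)))
      = ε * ∑ i : Fin 3,
          fderiv ℝ (fun y : E3 => fderiv ℝ (ρ t) y (EuclideanSpace.single i (1:ℝ))) x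
            (EuclideanSpace.single i (1:ℝ)))
    (hρ0low : ∀ x : E3, ρlow ≤ ρ 0 x) (hρ0high : ∀ x : E3, ρ 0 x ≤ ρhigh)
    (hρlow : 0 < ρlow) :
    ∀ t ∈ Set.Icc (0:ℝ) T, ∀ x : E3,
      ρlow * Real.exp (- ∫ s in (0:ℝ)..t, ⨆ y : E3,
          |∑ i : Fin 3, fderiv ℝ (u s) y (EuclideanSpace.single i (1:ℝ)) i|)
        ≤ ρ t x ∧
      ρ t x ≤ ρhigh * Real.exp (∫ s in (0:ℝ)..t, ⨆ y : E3,
          |∑ i : Fin 3, fderiv ℝ (u s) y (EuclideanSpace.single i (1:ℝ)) i|) := by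
  have hdc : ContinuousOn (fun q : ℝ × E3 => divergence (u q.1) q.2)
      (Set.Icc 0 T ×ˢ (Set.univ : Set E3)) :=
    continuousOn_finsetSum _ fun i _ =>
      (EuclideanSpace.proj i : E3 →L[ℝ] ℝ).continuous.comp_continuousOn
        (hudcont.clm_apply continuousOn_const)
  obtain ⟨m, hmc, hmeq, hm⟩ := exists_continuous_eq_iSup_abs hT.le hdc
    fun t => divergence_add_single (huper t)
  set A : ℝ → ℝ := fun t => ∫ s in (0 : ℝ)..t, m s
  have hAd : ∀ t, HasDerivAt A (m t) t := fun t =>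
    intervalIntegral.integral_hasDerivAt_right (hmc.intervalIntegrable _ _)
      (hmc.stronglyMeasurableAtFilter _ _) hmc.continuousAt
  have hA0 : A 0 = 0 := intervalIntegral.integral_same
  have hAeq : ∀ t ∈ Set.Icc 0 T, (∫ s in (0 : ℝ)..t, ⨆ y : E3,
      |∑ i : Fin 3, fderiv ℝ (u s) y (EuclideanSpace.single i (1 : ℝ)) i|) = A t := by
    intro t ht
    refine intervalIntegral.integral_congr fun s hs => ?_
    rw [Set.uIcc_of_le ht.1] at hs
    exact (hmeq s ⟨hs.1, hs.2.trans ht.2⟩).symm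
  have hred : ∀ x, ∃ y ∈ unitCube, ∀ t, ρ t y = ρ t x := fun x => by
    obtain ⟨y, hy, hyx⟩ := exists_mem_unitCube_forall_eq x
    exact ⟨y, hy, fun t => hyx (ρ t) (hρper t)⟩
  have hred' : ∀ x, ∃ y ∈ unitCube, ∀ t, -ρ t y = -ρ t x := fun x => by
    simpa only [neg_inj] using hred x
  have hder : ∀ t ∈ Set.Icc 0 T, ∀ x,
      HasDerivAt (fun s => ρ s x) (deriv (fun s => ρ s x) t) t :=
    fun t ht x => (hρt x t ht).hasDerivAt
  have hpde : ∀ t ∈ Set.Icc 0 T, ∀ x, fderiv ℝ (ρ t) x = 0 →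
      deriv (fun s => ρ s x) t + ρ t x * divergence (u t) x = ε * ∑ i : Fin 3,
        fderiv ℝ (fun y : E3 => fderiv ℝ (ρ t) y (EuclideanSpace.single i (1 : ℝ))) x
          (EuclideanSpace.single i (1 : ℝ)) := fun t ht x hx => by
    rw [← hPDE t ht x, sum_fderiv_mul_apply ((hρx t ht).differentiable (by norm_num) x)
      (hudiff t ht x)]
    simp [hx]
  have hatmax : ∀ t ∈ Set.Icc 0 T, ∀ x, (∀ y, ρ t y ≤ ρ t x) →
      deriv (fun s => ρ s x) t + ρ t x * divergence (u t) x ≤ 0 := fun t ht x hx => by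
    rw [hpde t ht x (IsLocalMax.fderiv_eq_zero (Filter.Eventually.of_forall hx))]
    exact mul_nonpos_of_nonneg_of_nonpos hε.le
      (Finset.sum_nonpos fun i _ => fderiv_fderiv_nonpos_of_forall_le (hρx t ht) hx _)
  have hatmin : ∀ t ∈ Set.Icc 0 T, ∀ x, (∀ y, -ρ t y ≤ -ρ t x) →
      0 ≤ deriv (fun s => ρ s x) t + ρ t x * divergence (u t) x := fun t ht x hx => by
    rw [hpde t ht x (IsLocalMin.fderiv_eq_zero
      (Filter.Eventually.of_forall fun y => neg_le_neg_iff.1 (hx y)))]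
    refine mul_nonneg hε.le (Finset.sum_nonneg fun i _ => ?_)
    have := fderiv_fderiv_nonpos_of_forall_le (hρx t ht).neg hx (EuclideanSpace.single i (1 : ℝ))
    simpa [fderiv_fun_neg] using this
  have hupper := le_mul_exp_of_deriv_le_at_max isCompact_unitCube hρcont hred hder hAd hA0
    hρ0high fun t ht x hx hc => by
      have hpos : 0 < ρ t x := pos_of_mul_pos_left
        (((hρlow.trans_le (hρ0low 0)).trans_le (hρ0high 0)).trans hc) (Real.exp_pos _).le
      nlinarith [hatmax t ht x hx, neg_le_of_abs_le (hm t ht x)]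
  have hnonneg := le_mul_exp_of_deriv_le_at_max isCompact_unitCube hρcont.neg hred'
    (fun t ht x => (hder t ht x).neg) hAd hA0 (c := 0)
    (fun x => by simpa using hρlow.le.trans (hρ0low x)) fun t ht x hx hc => by
      have hneg : 0 < -ρ t x := pos_of_mul_pos_left hc (Real.exp_pos _).le
      nlinarith [hatmin t ht x hx, neg_le_of_abs_le (hm t ht x)]
  have hlower := le_mul_exp_of_deriv_le_at_max isCompact_unitCube hρcont.neg hred'
    (fun t ht x => (hder t ht x).neg) (fun t => (hAd t).neg) (by simp [hA0])
    (fun x => neg_le_neg (hρ0low x)) fun t ht x hx _ => by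
      have h := hnonneg t ht x
      rw [zero_mul] at h
      nlinarith [hatmin t ht x hx, le_of_abs_le (hm t ht x)]
  intro t ht x
  rw [hAeq t ht]
  refine ⟨?_, hupper t ht x⟩
  have := hlower t ht x
  simp only [Pi.neg_apply] at this
  linarith
end
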